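/- arXiv:math/0607659 — 3 statements merged into one kernel-verified Lean document; each statement's English description precedes it below -/
import Mathlib

section
/- Let σ be a bounded continuous function on ℝⁿ × ℝⁿ ≅ ℝ^{2n} belonging to B^{n,1}_∞(ℝ^{2n}), i.e. ∑_{j≥0} 2^{jn} sup_{h∈ℝ^{2n}, 0<|h|≤2^{−j}} ‖Δ_h^{n+1} σ‖_∞ < ∞. Then there exists a constant C such that ‖σ(x,D)f‖_{L²(ℝⁿ)} ≤ C ‖f‖_{L²(ℝⁿ)} for every Schwartz function f on ℝⁿ; that is, σ(x,D) extends to a bounded operator from L²(ℝⁿ) to L²(ℝⁿ). -/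
open MeasureTheory Complex
open scoped RealInnerProductSpace ENNReal NNReal

noncomputable section

abbrev En (n : ℕ) : Type := EuclideanSpace ℝ (Fin n)

/-- The difference operator `Δ_h g(X) = g(X+h) − g(X)`. -/
def idiff {V : Type*} [Add V] (h : V) (g : V → ℂ) : V → ℂ := fun X => g (X + h) - g X

/-- The Fourier transform `f̂(ξ) = ∫ e^{−i x·ξ} f(x) dx`. -/
def ftI (n : ℕ) (f : En n → ℂ) (ξ : En n) : ℂ :=
  ∫ x : En n, Complex.exp (-(Complex.I * ((⟪x, ξ⟫ : ℝ) : ℂ))) * f x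

/-- The Euclidean norm of `h = (h₁,h₂) ∈ ℝⁿ × ℝⁿ ≅ ℝ^{2n}`. -/
def pnorm2 (n : ℕ) (h : En n × En n) : ℝ := Real.sqrt (‖h.1‖ ^ 2 + ‖h.2‖ ^ 2)

open FourierTransform SchwartzMap in
lemma planch_ae (n : ℕ) (f : En n → ℂ) (h1 : Integrable f) (h2 : MemLp f 2) :
    (𝓕 (h2.toLp f) : Lp ℂ 2 (volume : Measure (En n))) =ᵐ[volume] (𝓕 f : En n → ℂ) := by
  have hc : Continuous (𝓕 f : En n → ℂ) :=
    VectorFourier.fourierIntegral_continuous Real.continuous_fourierChar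
      (by exact continuous_inner) h1
  have hloc : LocallyIntegrable (𝓕 (h2.toLp f) : Lp ℂ 2 (volume : Measure (En n))) volume :=
    (Lp.memLp _).locallyIntegrable (by norm_num)
  apply ae_eq_of_integral_contDiff_smul_eq hloc hc.locallyIntegrable
  intro g hg hgs
  have hs : HasCompactSupport (fun x => (g x : ℂ)) := hgs.comp_left (g := fun t : ℝ => (t:ℂ)) (by simp)
  have hsm : ContDiff ℝ ((⊤ : ℕ∞) : WithTop ℕ∞) (fun x => (g x : ℂ)) := Complex.ofRealCLM.contDiff.comp hg
  let G : 𝓢(En n, ℂ) := hs.toSchwartzMap hsm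
  have key := congrArg (fun T : 𝓢'(En n, ℂ) => T G) (Lp.fourier_toTemperedDistribution_eq (h2.toLp f))
  simp only [TemperedDistribution.fourier_apply, Lp.toTemperedDistribution_apply] at key
  have e1 : ∫ x, g x • (𝓕 (h2.toLp f) : Lp ℂ 2 (volume : Measure (En n))) x =
      ∫ x, G x • (𝓕 (h2.toLp f) : Lp ℂ 2 (volume : Measure (En n))) x := by
    congr 1
  rw [e1, ← key]
  have e2 : ∫ x, (𝓕 G) x • (h2.toLp f) x = ∫ x, (𝓕 G) x • f x := by
    apply integral_congr_ae
    filter_upwards [h2.coeFn_toLp] with x hx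
    rw [hx]
  rw [e2]
  have e3 := VectorFourier.integral_fourierIntegral_smul_eq_flip (L := innerₗ (En n)) (μ := volume)
    (ν := volume) Real.continuous_fourierChar continuous_inner G.integrable h1
  have e4 : (innerₗ (En n)).flip = innerₗ (En n) := by
    ext x y; simp
  rw [e4] at e3
  exact e3

open FourierTransform SchwartzMap in
lemma planch0 (n : ℕ) (f : En n → ℂ) (h1 : Integrable f) (h2 : MemLp f 2) :
    ∫⁻ y, ‖(𝓕 f : En n → ℂ) y‖ₑ ^ 2 = ∫⁻ x, ‖f x‖ₑ ^ 2 := by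
  have a := planch_ae n f h1 h2
  have b : eLpNorm (𝓕 f : En n → ℂ) 2 volume = eLpNorm f 2 volume := by
    rw [← eLpNorm_congr_ae a]
    have := Lp.norm_fourier_eq (h2.toLp f)
    rw [Lp.norm_def, Lp.norm_def, ENNReal.toReal_eq_toReal_iff' (Lp.eLpNorm_ne_top _)
      (Lp.eLpNorm_ne_top _)] at this
    rw [this, eLpNorm_congr_ae h2.coeFn_toLp]
  have c := congrArg (fun t => t ^ 2) b
  have d : ∀ g : En n → ℂ, eLpNorm g 2 volume ^ 2 = ∫⁻ x, ‖g x‖ₑ ^ 2 := by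
    intro g
    have := eLpNorm_nnreal_pow_eq_lintegral (f := g) (μ := volume) (p := 2) (by norm_num)
    simpa using! this
  simpa only [d] using c

/-- the constant `(2π)^n` -/
def Pn (n : ℕ) : ℝ≥0∞ := ENNReal.ofReal ((2 * Real.pi) ^ n)

open FourierTransform SchwartzMap in
lemma ft_eq (n : ℕ) (f : En n → ℂ) (y : En n) :
    ∫ ξ : En n, Complex.exp (I * ((⟪y, ξ⟫ : ℝ) : ℂ)) * f ξ = (𝓕 f : En n → ℂ) (-(2 * Real.pi)⁻¹ • y) := by
  rw [Real.fourier_eq]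
  congr 1; ext ξ
  rw [Circle.smul_def, Real.fourierChar_apply, smul_eq_mul]
  congr 2
  rw [inner_smul_right, real_inner_comm]
  push_cast
  have : (Real.pi : ℂ) ≠ 0 := by exact_mod_cast Real.pi_ne_zero
  field_simp

lemma lint_smul (n : ℕ) (f : En n → ℝ≥0∞) (hf : Measurable f) {r : ℝ} (hr : r ≠ 0) :
    ∫⁻ y, f (r • y) = ENNReal.ofReal (abs (r ^ n)⁻¹) * ∫⁻ y, f y := by
  have h := lintegral_map (μ := (volume : Measure (En n))) hf (measurable_const_smul r)
  rw [← h, Measure.map_addHaar_smul _ hr, lintegral_smul_measure]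
  simp

lemma planch (n : ℕ) (f : En n → ℂ) (h1 : Integrable f) (h2 : MemLp f 2) :
    ∫⁻ y : En n, ‖∫ ξ : En n, Complex.exp (I * ((⟪y, ξ⟫ : ℝ) : ℂ)) * f ξ‖ₑ ^ 2
      = Pn n * ∫⁻ x, ‖f x‖ₑ ^ 2 := by
  simp_rw [ft_eq]
  rw [← planch0 n f h1 h2]
  have hc : Continuous (FourierTransform.fourier f : En n → ℂ) :=
    VectorFourier.fourierIntegral_continuous Real.continuous_fourierChar
      (by exact continuous_inner) h1
  have hp : 0 < (2 * Real.pi) := by positivity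
  have := lint_smul n (fun y => ‖(FourierTransform.fourier f : En n → ℂ) y‖ₑ ^ 2)
    (by have := hc.measurable; fun_prop) (r := -(2 * Real.pi)⁻¹)
    (neg_ne_zero.mpr (inv_ne_zero hp.ne'))
  rw [this]
  congr 1
  rw [Pn]
  congr 1
  rw [← inv_pow, inv_neg, inv_inv, abs_pow, abs_neg, abs_of_pos hp]

lemma cs2 {α : Type*} [MeasurableSpace α] (μ : Measure α) (f g : α → ℝ≥0∞) (hf : Measurable f)
    (hg : Measurable g) :
    ∫⁻ x, f x * g x ∂μ ≤ (∫⁻ x, f x ^ 2 ∂μ) ^ (1/2 : ℝ) * (∫⁻ x, g x ^ 2 ∂μ) ^ (1/2 : ℝ) := by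
  have := ENNReal.lintegral_mul_le_Lp_mul_Lq μ (p := 2) (q := 2) (by constructor <;> norm_num)
    hf.aemeasurable hg.aemeasurable
  simpa using this

lemma norm_expI (t : ℝ) : ‖Complex.exp (I * (t : ℂ))‖ = 1 := by
  rw [mul_comm]; exact Complex.norm_exp_ofReal_mul_I t

lemma integrable_bdd_mul {n : ℕ} {φ b : En n → ℂ} (h1 : Integrable φ) (hb : Measurable b) (M : ℝ)
    (hM : ∀ u, ‖b u‖ ≤ M) : Integrable (fun x => b x * φ x) :=
  h1.bdd_mul hb.aestronglyMeasurable (Filter.Eventually.of_forall hM)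

lemma meas_win (n : ℕ) (a φ : En n → ℂ) (ha : Measurable a) (hφ : Measurable φ) :
    Measurable (fun Y : En n × En n =>
      ∫ ξ : En n, Complex.exp (I * ((⟪Y.1, ξ⟫ : ℝ) : ℂ)) * (a (ξ - Y.2) * φ ξ)) := by
  apply StronglyMeasurable.measurable
  apply StronglyMeasurable.integral_prod_right
  apply Measurable.stronglyMeasurable
  unfold Function.uncurry
  fun_prop

lemma win1 (n : ℕ) (a φ : En n → ℂ) (ha : Measurable a) (M : ℝ) (haM : ∀ u, ‖a u‖ ≤ M)
    (hφ : Measurable φ) (h1 : Integrable φ) (h2 : MemLp φ 2) :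
    ∫⁻ Y : En n × En n, ‖∫ ξ : En n, Complex.exp (I * ((⟪Y.1, ξ⟫ : ℝ) : ℂ)) *
      (a (ξ - Y.2) * φ ξ)‖ₑ ^ 2 ≤ Pn n * (∫⁻ u, ‖a u‖ₑ ^ 2) * ∫⁻ x, ‖φ x‖ₑ ^ 2 := by
  have hm := meas_win n a φ ha hφ
  rw [Measure.volume_eq_prod, lintegral_prod_symm' _ (by fun_prop)]
  have e : ∀ η : En n, ∫⁻ y : En n, ‖∫ ξ : En n, Complex.exp (I * ((⟪y, ξ⟫ : ℝ) : ℂ)) *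
      (a (ξ - η) * φ ξ)‖ₑ ^ 2 = Pn n * ∫⁻ ξ, ‖a (ξ - η)‖ₑ ^ 2 * ‖φ ξ‖ₑ ^ 2 := by
    intro η
    have hma : Measurable (fun ξ => a (ξ - η)) := by fun_prop
    rw [planch n (fun ξ => a (ξ - η) * φ ξ)
      (integrable_bdd_mul h1 hma M (fun u => haM _)) ?_]
    · simp_rw [enorm_mul, mul_pow]
    · exact MemLp.of_le_mul (c := M) h2 (by fun_prop) (Filter.Eventually.of_forall fun x => by
        rw [norm_mul]; gcongr; exact haM _)
  simp only [e]
  rw [lintegral_const_mul _ (by fun_prop), lintegral_lintegral_swap (by fun_prop), mul_assoc]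
  gcongr
  have e2 : ∀ ξ : En n, ∫⁻ η, ‖a (ξ - η)‖ₑ ^ 2 * ‖φ ξ‖ₑ ^ 2 = (∫⁻ u, ‖a u‖ₑ ^ 2) * ‖φ ξ‖ₑ ^ 2 := by
    intro ξ
    rw [lintegral_mul_const _ (by fun_prop)]
    congr 1
    exact lintegral_sub_left_eq_self (fun u => ‖a u‖ₑ ^ 2) ξ
  simp only [e2]
  rw [lintegral_const_mul _ (by fun_prop)]

lemma win2 (n : ℕ) (a φ : En n → ℂ) (ha : Measurable a) (M : ℝ) (haM : ∀ u, ‖a u‖ ≤ M)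
    (hφ : Measurable φ) (h1 : Integrable φ) (h2 : MemLp φ 2) :
    ∫⁻ Y : En n × En n, ‖∫ ξ : En n, Complex.exp (I * ((⟪Y.2, ξ⟫ : ℝ) : ℂ)) *
      (a (ξ - Y.1) * φ ξ)‖ₑ ^ 2 ≤ Pn n * (∫⁻ u, ‖a u‖ₑ ^ 2) * ∫⁻ x, ‖φ x‖ₑ ^ 2 := by
  refine le_trans (le_of_eq ?_) (win1 n a φ ha M haM hφ h1 h2)
  have hm := meas_win n a φ ha hφ
  exact (Measure.measurePreserving_swap (μ := (volume : Measure (En n)))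
    (ν := (volume : Measure (En n)))).lintegral_comp
      (f := fun Y : En n × En n => ‖∫ ξ : En n, Complex.exp (I * ((⟪Y.1, ξ⟫ : ℝ) : ℂ)) *
      (a (ξ - Y.2) * φ ξ)‖ₑ ^ 2) (by fun_prop)

/-- indicator window -/
def bw (n : ℕ) (ρ : ℝ) : En n → ℂ := (Metric.closedBall (0 : En n) ρ).indicator 1

lemma meas_bw (n : ℕ) (ρ : ℝ) : Measurable (bw n ρ) :=
  measurable_one.indicator Metric.isClosed_closedBall.measurableSet

lemma bw_norm_le (n : ℕ) (ρ : ℝ) (u : En n) : ‖bw n ρ u‖ ≤ 1 := by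
  unfold bw
  by_cases h : u ∈ Metric.closedBall (0 : En n) ρ <;> simp [h]

/-- polynomial window -/
def bwp (n : ℕ) (ρ : ℝ) {k : ℕ} (p : Fin k → Fin n) (u : En n) : ℂ :=
  bw n ρ u * ∏ l, ((u (p l) : ℝ) : ℂ)

lemma meas_bwp (n : ℕ) (ρ : ℝ) {k : ℕ} (p : Fin k → Fin n) : Measurable (bwp n ρ p) := by
  unfold bwp
  have := meas_bw n ρ
  fun_prop

lemma bwp_norm_le (n : ℕ) (ρ : ℝ) (hρ : 0 ≤ ρ) {k : ℕ} (p : Fin k → Fin n) (u : En n) :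
    ‖bwp n ρ p u‖ ≤ ρ ^ k * ‖bw n ρ u‖ := by
  unfold bwp bw
  by_cases h : u ∈ Metric.closedBall (0 : En n) ρ
  · simp only [h, Set.indicator_of_mem, Pi.one_apply, one_mul, norm_prod, norm_one, mul_one]
    rw [mem_closedBall_zero_iff] at h
    calc ∏ l, ‖((u (p l) : ℝ) : ℂ)‖ ≤ ∏ l : Fin k, ρ := by
          apply Finset.prod_le_prod
          · intros; positivity
          · intro l _
            rw [Complex.norm_real]
            exact (PiLp.norm_apply_le u (p l)).trans h
      _ = ρ ^ k := by simp
  · simp [h]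

lemma bwp_l2 (n : ℕ) (ρ : ℝ) (hρ : 0 ≤ ρ) {k : ℕ} (p : Fin k → Fin n) :
    ∫⁻ u, ‖bwp n ρ p u‖ₑ ^ 2 ≤ ENNReal.ofReal (ρ ^ (2 * k)) * volume (Metric.closedBall (0 : En n) ρ) := by
  have hs : MeasurableSet (Metric.closedBall (0 : En n) ρ) := Metric.isClosed_closedBall.measurableSet
  calc ∫⁻ u, ‖bwp n ρ p u‖ₑ ^ 2 ≤ ∫⁻ u, (Metric.closedBall (0 : En n) ρ).indicator
        (fun _ => ENNReal.ofReal (ρ ^ (2 * k))) u := by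
        apply lintegral_mono
        intro u
        have := bwp_norm_le n ρ hρ p u
        by_cases h : u ∈ Metric.closedBall (0 : En n) ρ
        · simp only [h, Set.indicator_of_mem]
          rw [← ofReal_norm, ← ENNReal.ofReal_pow (norm_nonneg _), mul_comm 2 k, pow_mul]
          gcongr
          refine this.trans ?_
          have := bw_norm_le n ρ u
          have : 0 ≤ ρ ^ k := by positivity
          nlinarith
        · simp [bwp, bw, h]
    _ = _ := by rw [lintegral_indicator hs]; simp

lemma inner_pow_eq (n k : ℕ) (u v : En n) :
    (((⟪u, v⟫ : ℝ) : ℂ)) ^ k =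
      ∑ p : Fin k → Fin n, (∏ l, ((u (p l) : ℝ) : ℂ)) * ∏ l, ((v (p l) : ℝ) : ℂ) := by
  have : (((⟪u, v⟫ : ℝ) : ℂ)) = ∑ i, ((u i : ℝ) : ℂ) * ((v i : ℝ) : ℂ) := by
    rw [PiLp.inner_apply]
    push_cast
    apply Finset.sum_congr rfl
    intro i _
    simp [mul_comm]
  rw [this, Fintype.sum_pow]
  simp_rw [Finset.prod_mul_distrib]

lemma phase_eq (n : ℕ) (x ξ y η : En n) :
    Complex.exp (I * ((⟪x, ξ⟫ : ℝ) : ℂ)) = Complex.exp (I * ((-⟪y, η⟫ : ℝ) : ℂ)) *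
      Complex.exp (I * ((⟪y, ξ⟫ : ℝ) : ℂ)) * Complex.exp (I * ((⟪η, x⟫ : ℝ) : ℂ)) *
      Complex.exp (I * ((⟪x - y, ξ - η⟫ : ℝ) : ℂ)) := by
  rw [← Complex.exp_add, ← Complex.exp_add, ← Complex.exp_add]
  congr 1
  rw [inner_sub_left, inner_sub_right, inner_sub_right, real_inner_comm x η]
  push_cast
  ring

/-- windowed bilinear form -/
def HY (n : ℕ) (ρ : ℝ) (g φ : En n → ℂ) (Y : En n × En n) : ℂ :=
  ∫ Z : En n × En n, Complex.exp (I * ((⟪Z.1, Z.2⟫ : ℝ) : ℂ)) *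
    (bw n ρ (Z.1 - Y.1) * bw n ρ (Z.2 - Y.2)) * (g Z.1 * φ Z.2)

/-- window transform of g -/
def GA (n : ℕ) (ρ : ℝ) (g : En n → ℂ) {k : ℕ} (p : Fin k → Fin n) (Y : En n × En n) : ℂ :=
  ∫ x : En n, Complex.exp (I * ((⟪Y.2, x⟫ : ℝ) : ℂ)) * (bwp n ρ p (x - Y.1) * g x)
/-- window transform of φ -/
def FB (n : ℕ) (ρ : ℝ) (g : En n → ℂ) {k : ℕ} (p : Fin k → Fin n) (Y : En n × En n) : ℂ :=
  ∫ x : En n, Complex.exp (I * ((⟪Y.1, x⟫ : ℝ) : ℂ)) * (bwp n ρ p (x - Y.2) * g x)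

/-- Taylor term -/
def TF (n : ℕ) (ρ : ℝ) (g φ : En n → ℂ) (Y : En n × En n) (k : ℕ) (Z : En n × En n) : ℂ :=
  Complex.exp (I * ((-⟪Y.1, Y.2⟫ : ℝ) : ℂ)) *
      Complex.exp (I * ((⟪Y.1, Z.2⟫ : ℝ) : ℂ)) * Complex.exp (I * ((⟪Y.2, Z.1⟫ : ℝ) : ℂ)) *
      ((I * ((⟪Z.1 - Y.1, Z.2 - Y.2⟫ : ℝ) : ℂ)) ^ k / (k.factorial : ℂ)) *
      (bw n ρ (Z.1 - Y.1) * bw n ρ (Z.2 - Y.2)) * (g Z.1 * φ Z.2)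

lemma TF_hasSum (n : ℕ) (ρ : ℝ) (g φ : En n → ℂ) (Y Z : En n × En n) :
    HasSum (fun k => TF n ρ g φ Y k Z) (Complex.exp (I * ((⟪Z.1, Z.2⟫ : ℝ) : ℂ)) *
    (bw n ρ (Z.1 - Y.1) * bw n ρ (Z.2 - Y.2)) * (g Z.1 * φ Z.2)) := by
  rw [phase_eq n Z.1 Z.2 Y.1 Y.2]
  unfold TF
  apply HasSum.mul_right
  apply HasSum.mul_right
  apply HasSum.mul_left
  have := NormedSpace.expSeries_div_hasSum_exp (I * ((⟪Z.1 - Y.1, Z.2 - Y.2⟫ : ℝ) : ℂ))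
  rw [Complex.exp_eq_exp_ℂ]
  exact this

lemma TF_norm_le (n : ℕ) (ρ : ℝ) (hρ : 0 ≤ ρ) (g φ : En n → ℂ) (Y : En n × En n) (k : ℕ) (Z : En n × En n) :
    ‖TF n ρ g φ Y k Z‖ ≤ (ρ ^ 2) ^ k / k.factorial * (‖g Z.1‖ * ‖φ Z.2‖) := by
  unfold TF
  simp only [norm_mul, norm_expI, one_mul, norm_div, norm_pow, Complex.norm_I, Complex.norm_real,
    Complex.norm_natCast]
  by_cases h1 : Z.1 - Y.1 ∈ Metric.closedBall (0 : En n) ρ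
  swap
  · simp only [bw, h1, not_false_eq_true, Set.indicator_of_notMem, norm_zero, zero_mul, mul_zero]
    positivity
  by_cases h2 : Z.2 - Y.2 ∈ Metric.closedBall (0 : En n) ρ
  swap
  · simp only [bw, h2, not_false_eq_true, Set.indicator_of_notMem, norm_zero, zero_mul, mul_zero]
    positivity
  simp only [bw, h1, h2, Set.indicator_of_mem, Pi.one_apply, norm_one, mul_one]
  rw [mem_closedBall_zero_iff] at h1 h2
  gcongr
  calc ‖⟪Z.1 - Y.1, Z.2 - Y.2⟫‖ ≤ ‖Z.1 - Y.1‖ * ‖Z.2 - Y.2‖ := norm_inner_le_norm _ _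
    _ ≤ ρ * ρ := by gcongr
    _ = ρ ^ 2 := by ring

lemma TF_eq (n : ℕ) (ρ : ℝ) (g φ : En n → ℂ) (Y : En n × En n) (k : ℕ) (Z : En n × En n) :
    TF n ρ g φ Y k Z = (Complex.exp (I * ((-⟪Y.1, Y.2⟫ : ℝ) : ℂ)) * (I ^ k / (k.factorial : ℂ))) *
      ∑ p : Fin k → Fin n,
      (Complex.exp (I * ((⟪Y.2, Z.1⟫ : ℝ) : ℂ)) * (bwp n ρ p (Z.1 - Y.1) * g Z.1)) *
      (Complex.exp (I * ((⟪Y.1, Z.2⟫ : ℝ) : ℂ)) * (bwp n ρ p (Z.2 - Y.2) * φ Z.2)) := by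
  unfold TF bwp
  rw [mul_pow, inner_pow_eq, Finset.mul_sum, Finset.sum_div, Finset.mul_sum, Finset.sum_mul,
    Finset.sum_mul, Finset.mul_sum]
  apply Finset.sum_congr rfl
  intro p _
  ring

lemma meas_TF (n : ℕ) (ρ : ℝ) (g φ : En n → ℂ) (hg : Measurable g) (hφ : Measurable φ)
    (Y : En n × En n) (k : ℕ) : Measurable (TF n ρ g φ Y k) := by
  have := meas_bw n ρ
  unfold TF
  fun_prop

lemma int_exp_bwp (n : ℕ) (ρ : ℝ) (hρ : 0 ≤ ρ) (g : En n → ℂ)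
    (hg1 : Integrable g) {k : ℕ} (p : Fin k → Fin n) (y η : En n) :
    Integrable (fun x => Complex.exp (I * ((⟪η, x⟫ : ℝ) : ℂ)) * (bwp n ρ p (x - y) * g x)) := by
  have := meas_bwp n ρ p
  apply integrable_bdd_mul (integrable_bdd_mul hg1 (by fun_prop) (ρ ^ k) ?_) (by fun_prop) 1
  · intro u; rw [norm_expI]
  · intro u
    refine (bwp_norm_le n ρ hρ p (u - y)).trans ?_
    have := bw_norm_le n ρ (u - y)
    have : 0 ≤ ρ ^ k := by positivity
    nlinarith

lemma TF_integral (n : ℕ) (ρ : ℝ) (hρ : 0 ≤ ρ) (g φ : En n → ℂ)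
    (hg1 : Integrable g) (hφ1 : Integrable φ) (Y : En n × En n) (k : ℕ) :
    ∫ Z, TF n ρ g φ Y k Z =
     (Complex.exp (I * ((-⟪Y.1, Y.2⟫ : ℝ) : ℂ)) * (I ^ k / (k.factorial : ℂ))) *
      ∑ p : Fin k → Fin n, GA n ρ g p Y * FB n ρ φ p Y := by
  simp_rw [TF_eq]
  rw [integral_const_mul, integral_finsetSum]
  · congr 1
    apply Finset.sum_congr rfl
    intro p _
    unfold GA FB
    rw [← integral_prod_mul]
    rfl
  · intro p _
    exact (int_exp_bwp n ρ hρ g hg1 p Y.1 Y.2).mul_prod (int_exp_bwp n ρ hρ φ hφ1 p Y.2 Y.1)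

lemma HY_le (n : ℕ) (ρ : ℝ) (hρ : 0 ≤ ρ) (g φ : En n → ℂ) (hg : Measurable g) (hφ : Measurable φ)
    (hg1 : Integrable g) (hφ1 : Integrable φ) (Y : En n × En n) :
    ‖HY n ρ g φ Y‖ₑ ≤ ∑' k : ℕ, ENNReal.ofReal (1 / k.factorial) *
      ∑ p : Fin k → Fin n, ‖GA n ρ g p Y‖ₑ * ‖FB n ρ φ p Y‖ₑ := by
  have hI : Integrable (fun Z : En n × En n => ‖g Z.1‖ * ‖φ Z.2‖) := hg1.norm.mul_prod hφ1.norm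
  have hintg : ∀ k, Integrable (TF n ρ g φ Y k) := by
    intro k
    refine (hI.const_mul ((ρ ^ 2) ^ k / k.factorial)).mono' (meas_TF n ρ g φ hg hφ Y k).aestronglyMeasurable
      (Filter.Eventually.of_forall fun Z => TF_norm_le n ρ hρ g φ Y k Z)
  have hsum : Summable (fun k => ∫ Z, ‖TF n ρ g φ Y k Z‖) := by
    have h0 : Summable (fun k : ℕ => (ρ ^ 2) ^ k / k.factorial * ∫ Z : En n × En n, ‖g Z.1‖ * ‖φ Z.2‖) :=
      (Real.summable_pow_div_factorial (ρ ^ 2)).mul_right _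
    refine Summable.of_nonneg_of_le (fun k => by positivity) (fun k => ?_) h0
    rw [← integral_const_mul]
    exact integral_mono (hintg k).norm (hI.const_mul _) (fun Z => TF_norm_le n ρ hρ g φ Y k Z)
  have hs := hasSum_integral_of_summable_integral_norm hintg hsum
  have e : HY n ρ g φ Y = ∑' k, ∫ Z, TF n ρ g φ Y k Z := by
    rw [hs.tsum_eq]
    unfold HY
    congr 1; ext Z
    exact (TF_hasSum n ρ g φ Y Z).tsum_eq.symm
  rw [e]
  refine enorm_tsum_le_tsum_enorm.trans (ENNReal.tsum_le_tsum fun k => ?_)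
  rw [TF_integral n ρ hρ g φ hg1 hφ1, enorm_mul]
  gcongr
  · rw [← ofReal_norm, norm_mul, norm_expI]
    simp
  · refine (enorm_sum_le _ _).trans (Finset.sum_le_sum fun p _ => ?_)
    rw [enorm_mul]

lemma HY_term (n : ℕ) (ρ : ℝ) (hρ : 0 ≤ ρ) (g φ : En n → ℂ) (hg : Measurable g) (hφ : Measurable φ)
    (hg1 : Integrable g) (hφ1 : Integrable φ) (hg2 : MemLp g 2) (hφ2 : MemLp φ 2)
    (hmF : ∀ {k : ℕ} (p : Fin k → Fin n), Measurable (FB n ρ φ p))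
    (hmG : ∀ {k : ℕ} (p : Fin k → Fin n), Measurable (GA n ρ g p))
    {k : ℕ} (p : Fin k → Fin n) : ∫⁻ Y, ‖GA n ρ g p Y‖ₑ * ‖FB n ρ φ p Y‖ₑ ≤
      Pn n * (ENNReal.ofReal (ρ ^ (2 * k)) * volume (Metric.closedBall (0 : En n) ρ)) *
      ((∫⁻ x, ‖g x‖ₑ ^ 2) ^ (1/2 : ℝ) * (∫⁻ x, ‖φ x‖ₑ ^ 2) ^ (1/2 : ℝ)) := by
  have hb : ∀ (u : En n), ‖bwp n ρ p u‖ ≤ ρ ^ k := by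
    intro u
    refine (bwp_norm_le n ρ hρ p u).trans ?_
    have := bw_norm_le n ρ u
    have : 0 ≤ ρ ^ k := by positivity
    nlinarith
  have b1 := (win2 n _ g (meas_bwp n ρ p) _ hb hg hg1 hg2).trans
    (mul_le_mul_left (mul_le_mul_right (bwp_l2 n ρ hρ p) _) _)
  have b2 := (win1 n _ φ (meas_bwp n ρ p) _ hb hφ hφ1 hφ2).trans
    (mul_le_mul_left (mul_le_mul_right (bwp_l2 n ρ hρ p) _) _)
  have c := cs2 volume _ _ (hmG p).enorm (hmF p).enorm
  change ∫⁻ Y, ‖GA n ρ g p Y‖ₑ ^ 2 ≤ _ at b1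
  change ∫⁻ Y, ‖FB n ρ φ p Y‖ₑ ^ 2 ≤ _ at b2
  refine c.trans ?_
  generalize Pn n * (ENNReal.ofReal (ρ ^ (2 * k)) * volume (Metric.closedBall (0 : En n) ρ)) = D at *
  generalize (∫⁻ Y, ‖GA n ρ g p Y‖ₑ ^ 2) = x1 at *
  generalize (∫⁻ Y, ‖FB n ρ φ p Y‖ₑ ^ 2) = x2 at *
  generalize (∫⁻ x, ‖g x‖ₑ ^ 2) = y1 at *
  generalize (∫⁻ x, ‖φ x‖ₑ ^ 2) = y2 at *
  calc _ ≤ (D * y1) ^ (1/2:ℝ) * (D * y2) ^ (1/2:ℝ) := by gcongr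
      _ = (D ^ (1/2:ℝ) * D ^ (1/2:ℝ)) * (y1 ^ (1/2:ℝ) * y2 ^ (1/2:ℝ)) := by
        rw [ENNReal.mul_rpow_of_nonneg _ _ (by norm_num), ENNReal.mul_rpow_of_nonneg _ _ (by norm_num)]
        ring
      _ = _ := by
        rw [← ENNReal.rpow_add_of_nonneg _ _ (by norm_num) (by norm_num)]
        norm_num

lemma sum_fact (n : ℕ) (ρ : ℝ) (P V N : ℝ≥0∞) :
    ∑' k : ℕ, ENNReal.ofReal (1 / k.factorial) *
      ∑ _p : Fin k → Fin n, P * (ENNReal.ofReal (ρ ^ (2 * k)) * V) * N =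
    P * V * ENNReal.ofReal (Real.exp (n * ρ ^ 2)) * N := by
  have h : ∀ k : ℕ, ENNReal.ofReal (1 / k.factorial) *
      ∑ _p : Fin k → Fin n, P * (ENNReal.ofReal (ρ ^ (2 * k)) * V) * N = (P * V * N) *
          ENNReal.ofReal ((n * ρ ^ 2) ^ k / k.factorial) := by
    intro k
    rw [Finset.sum_const, Finset.card_univ]
    simp only [Fintype.card_fun, Fintype.card_fin, nsmul_eq_mul]
    have : (n * ρ ^ 2) ^ k / k.factorial = (1 / k.factorial) * ((n ^ k : ℕ) * ρ ^ (2 * k)) := by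
      push_cast
      rw [mul_pow, ← pow_mul]; ring
    rw [this, ENNReal.ofReal_mul (by positivity), ENNReal.ofReal_mul (by positivity),
      ENNReal.ofReal_natCast]
    ring
  simp_rw [h]
  rw [ENNReal.tsum_mul_left, ← ENNReal.ofReal_tsum_of_nonneg (fun k => by positivity)
          (Real.summable_pow_div_factorial _), Real.exp_eq_exp_ℝ, NormedSpace.exp_eq_tsum_div]
  ring

lemma sum_swap (n : ℕ) (c : ℕ → ℝ≥0∞) (F : ∀ k : ℕ, (Fin k → Fin n) → En n × En n → ℝ≥0∞)
    (hmm : ∀ k p, Measurable (F k p)) :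
    ∫⁻ Y, ∑' k : ℕ, c k * ∑ p : Fin k → Fin n, F k p Y =
    ∑' k : ℕ, c k * ∑ p : Fin k → Fin n, ∫⁻ Y, F k p Y := by
  rw [lintegral_tsum (fun k =>
    Measurable.aemeasurable (Measurable.const_mul (Finset.measurable_sum _ fun p _ => hmm k p) _))]
  congr 1; ext k
  rw [lintegral_const_mul _ (Finset.measurable_sum _ fun p _ => hmm k p)]
  rw [lintegral_finsetSum _ (fun p _ => hmm k p)]

lemma meas_FB (n : ℕ) (ρ : ℝ) (φ : En n → ℂ) (hφ : Measurable φ) {k : ℕ} (p : Fin k → Fin n) :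
    Measurable (FB n ρ φ p) := meas_win n (bwp n ρ p) φ (meas_bwp n ρ p) hφ

lemma meas_GA (n : ℕ) (ρ : ℝ) (φ : En n → ℂ) (hφ : Measurable φ) {k : ℕ} (p : Fin k → Fin n) :
    Measurable (GA n ρ φ p) := by
  have ha := meas_bwp n ρ p
  unfold GA
  generalize bwp n ρ p = a at *
  apply StronglyMeasurable.measurable
  apply StronglyMeasurable.integral_prod_right
  apply Measurable.stronglyMeasurable
  unfold Function.uncurry
  fun_prop

lemma HY_int (n : ℕ) (ρ : ℝ) (hρ : 0 ≤ ρ) (g φ : En n → ℂ) (hg : Measurable g) (hφ : Measurable φ)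
    (hg1 : Integrable g) (hφ1 : Integrable φ) (hg2 : MemLp g 2) (hφ2 : MemLp φ 2) :
    ∫⁻ Y, ‖HY n ρ g φ Y‖ₑ ≤ Pn n * volume (Metric.closedBall (0 : En n) ρ) *
      ENNReal.ofReal (Real.exp (n * ρ ^ 2)) *
      ((∫⁻ x, ‖g x‖ₑ ^ 2) ^ (1/2 : ℝ) * (∫⁻ x, ‖φ x‖ₑ ^ 2) ^ (1/2 : ℝ)) := by
  rw [← sum_fact]
  refine (lintegral_mono fun Y => HY_le n ρ hρ g φ hg hφ hg1 hφ1 Y).trans ?_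
  rw [sum_swap n (fun k => ENNReal.ofReal (1 / k.factorial))
    (fun k p Y => ‖GA n ρ g p Y‖ₑ * ‖FB n ρ φ p Y‖ₑ)
    (fun k p => (meas_GA n ρ g hg p).enorm.mul (meas_FB n ρ φ hφ p).enorm)]
  refine ENNReal.tsum_le_tsum fun k => mul_le_mul_right (Finset.sum_le_sum fun p _ => ?_) _
  exact HY_term n ρ hρ g φ hg hφ hg1 hφ1 hg2 hφ2 (meas_FB n ρ φ hφ) (meas_GA n ρ g hg) p

/-- the operator with symbol s applied to φ (=f̂) -/
def opS (n : ℕ) (s : En n × En n → ℂ) (φ : En n → ℂ) (x : En n) : ℂ :=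
  ∫ ξ : En n, Complex.exp (I * ((⟪x, ξ⟫ : ℝ) : ℂ)) * s (x, ξ) * φ ξ

lemma meas_opS (n : ℕ) (s : En n × En n → ℂ) (φ : En n → ℂ) (hs : Measurable s)
    (hφ : Measurable φ) : Measurable (opS n s φ) := by
  unfold opS
  apply StronglyMeasurable.measurable
  apply StronglyMeasurable.integral_prod_right
  apply Measurable.stronglyMeasurable
  unfold Function.uncurry
  fun_prop

lemma opS_bdd (n : ℕ) (s : En n × En n → ℂ) (φ : En n → ℂ) (M : ℝ) (hM : ∀ X, ‖s X‖ ≤ M)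
    (h1 : Integrable φ) (x : En n) :
    ‖opS n s φ x‖ ≤ M * ∫ ξ, ‖φ ξ‖ := by
  unfold opS
  rw [← integral_const_mul]
  apply norm_integral_le_of_norm_le (h1.norm.const_mul M)
  refine Filter.Eventually.of_forall fun ξ => ?_
  rw [norm_mul, norm_mul, norm_expI, one_mul]
  gcongr
  exact hM _

lemma duality (n : ℕ) (h : En n → ℂ) (hm : Measurable h) (B : ℝ) (hB : ∀ x, ‖h x‖ ≤ B) (K : ℝ≥0∞)
    (H : ∀ g : En n → ℂ, Measurable g → Integrable g → MemLp g 2 →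
      ‖∫ x, h x * g x‖ₑ ≤ K * (∫⁻ x, ‖g x‖ₑ ^ 2) ^ (1/2 : ℝ)) :
    (∫⁻ x, ‖h x‖ₑ ^ 2) ^ (1/2 : ℝ) ≤ K := by
  have hloc : ∀ N : ℕ, ∫⁻ x in Metric.closedBall (0 : En n) N, ‖h x‖ₑ ^ 2 ≤ K ^ 2 := by
    intro N
    set S := Metric.closedBall (0 : En n) N
    have hS : MeasurableSet S := Metric.isClosed_closedBall.measurableSet
    have hv : volume S ≠ ⊤ := measure_closedBall_lt_top.ne
    set g : En n → ℂ := S.indicator (fun x => (starRingEnd ℂ) (h x)) with hg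
    have hgm : Measurable g := Measurable.indicator (by fun_prop) hS
    have hmem : ∀ p, MemLp g p := by
      intro p
      refine (memLp_indicator_iff_restrict hS).2 ?_
      have : IsFiniteMeasure (volume.restrict S) := ⟨by simpa using hv.lt_top⟩
      refine MemLp.of_bound (C := B) (by fun_prop) (Filter.Eventually.of_forall fun x => ?_)
      simpa using hB x
    have h0 := H g hgm (memLp_one_iff_integrable.1 (hmem 1)) (hmem 2)
    set T := ∫⁻ x in S, ‖h x‖ₑ ^ 2 with hT
    have e1 : ∫⁻ x, ‖g x‖ₑ ^ 2 = T := by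
      rw [hT, ← lintegral_indicator hS]
      congr 1; ext x
      by_cases hx : x ∈ S <;> simp [hg, hx]
    have hTt : T ≠ ⊤ := by
      rw [← e1]
      have := (hmem 2).eLpNorm_ne_top
      have h2 := eLpNorm_nnreal_pow_eq_lintegral (f := g) (μ := volume) (p := 2) (by norm_num)
      have h3 : eLpNorm g 2 volume ^ 2 = ∫⁻ x, ‖g x‖ₑ ^ 2 := by simpa using! h2
      rw [← h3]
      exact ENNReal.pow_ne_top this
    have e2 : ‖∫ x, h x * g x‖ₑ = T := by
      have : ∀ x, h x * g x = (((S.indicator (fun x => ‖h x‖ ^ 2) x : ℝ)) : ℂ) := by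
        intro x
        by_cases hx : x ∈ S
        · simp [hg, hx, Complex.mul_conj, Complex.normSq_eq_norm_sq]
        · simp [hg, hx]
      simp_rw [this]
      rw [integral_complex_ofReal, ← ofReal_norm, Complex.norm_real, Real.norm_of_nonneg]
      · rw [ofReal_integral_eq_lintegral_ofReal]
        · rw [hT, ← lintegral_indicator hS]
          congr 1; ext x
          by_cases hx : x ∈ S
          · simp [hx]
          · simp [hx]
        · rw [integrable_indicator_iff hS]
          have : IsFiniteMeasure (volume.restrict S) := ⟨by simpa using hv.lt_top⟩
          refine memLp_one_iff_integrable.1 (MemLp.of_bound (C := B ^ 2) (by fun_prop)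
            (Filter.Eventually.of_forall fun x => ?_))
          rw [norm_pow, norm_norm]
          gcongr
          exact hB x
        · exact Filter.Eventually.of_forall fun x => Set.indicator_nonneg (fun _ _ => by positivity) _
      · exact integral_nonneg fun x => Set.indicator_nonneg (fun _ _ => by positivity) _
    rw [e2, e1] at h0
    by_cases hz : T = 0
    · rw [hz]; exact zero_le
    have hq : T ^ (1/2:ℝ) ≠ 0 := by
      simp [hz]
    have hq' : T ^ (1/2:ℝ) ≠ ⊤ := by
      simp [hTt]
    have hsq : T ^ (1/2:ℝ) * T ^ (1/2:ℝ) = T := by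
      rw [← ENNReal.rpow_add_of_nonneg _ _ (by norm_num) (by norm_num)]
      norm_num
    have : T ^ (1/2:ℝ) ≤ K := by
      rw [← ENNReal.mul_le_mul_iff_left hq hq', hsq]
      exact h0
    rw [← hsq, pow_two]
    gcongr
  have hU : (⋃ N : ℕ, Metric.closedBall (0 : En n) N) = Set.univ := by
    exact Metric.iUnion_closedBall_nat 0
  have : ∫⁻ x, ‖h x‖ₑ ^ 2 ≤ K ^ 2 := by
    rw [← setLIntegral_univ, ← hU, setLIntegral_iUnion_of_directed]
    · exact iSup_le hloc
    · refine Monotone.directed_le fun a b hab => Metric.closedBall_subset_closedBall (by exact_mod_cast hab)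
  calc (∫⁻ x, ‖h x‖ₑ ^ 2) ^ (1/2 : ℝ) ≤ (K ^ 2) ^ (1/2 : ℝ) := by gcongr
    _ = K := by
      rw [← ENNReal.rpow_natCast, ← ENNReal.rpow_mul]; norm_num

instance haarP (n : ℕ) : (volume : Measure (En n × En n)).IsAddHaarMeasure := by
  rw [Measure.volume_eq_prod]; infer_instance

lemma bw_even (n : ℕ) (ρ : ℝ) (u v : En n) : bw n ρ (u - v) = bw n ρ (v - u) := by
  have : (u - v ∈ Metric.closedBall (0 : En n) ρ) ↔ (v - u ∈ Metric.closedBall (0 : En n) ρ) := by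
    rw [mem_closedBall_zero_iff, mem_closedBall_zero_iff, norm_sub_rev]
  unfold bw
  by_cases h : u - v ∈ Metric.closedBall (0 : En n) ρ
  · rw [Set.indicator_of_mem h, Set.indicator_of_mem (this.1 h)]; rfl
  · rw [Set.indicator_of_notMem h, Set.indicator_of_notMem (fun h' => h (this.2 h'))]

/-- the unit size product of balls -/
def SB (n : ℕ) : Set (En n × En n) := Metric.closedBall (0 : En n × En n) (1/2)

lemma SB_meas (n : ℕ) : MeasurableSet (SB n) := Metric.isClosed_closedBall.measurableSet

/-- volume of the ball of radius one half -/
def vb (n : ℕ) : ℝ≥0∞ := volume (Metric.closedBall (0 : En n) (1/2))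

lemma vb_ne_top (n : ℕ) : vb n ≠ ⊤ := measure_closedBall_lt_top.ne
lemma vb_ne_zero (n : ℕ) : vb n ≠ 0 := (Metric.measure_closedBall_pos _ _ (by norm_num)).ne'

lemma SB_vol (n : ℕ) : volume (SB n) = vb n * vb n := by
  have : SB n = Metric.closedBall (0 : En n) (1/2) ×ˢ Metric.closedBall (0 : En n) (1/2) := by
    rw [closedBall_prod_same]; rfl
  rw [this, Measure.volume_eq_prod, Measure.prod_prod]; rfl

/-- uniform probability measure -/
def muS (n : ℕ) : Measure (En n × En n) := ProbabilityTheory.cond volume (SB n)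

instance muS_prob (n : ℕ) : IsProbabilityMeasure (muS n) := by
  apply ProbabilityTheory.cond_isProbabilityMeasure_of_finite
  · rw [SB_vol]; simp [vb_ne_zero]
  · rw [SB_vol]; exact ENNReal.mul_ne_top (vb_ne_top n) (vb_ne_top n)

/-- averaging -/
def Av (n : ℕ) (r : ℝ) (τ : En n × En n → ℂ) (X : En n × En n) : ℂ := ∫ h, τ (X + r • h) ∂(muS n)

lemma Av_meas (n : ℕ) (r : ℝ) (τ : En n × En n → ℂ) (hτ : Measurable τ) : Measurable (Av n r τ) := by
  apply StronglyMeasurable.measurable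
  apply StronglyMeasurable.integral_prod_right
  apply Measurable.stronglyMeasurable
  unfold Function.uncurry
  fun_prop

lemma Av_bdd (n : ℕ) (r : ℝ) (τ : En n × En n → ℂ) (M : ℝ) (hM : ∀ X, ‖τ X‖ ≤ M) (X) :
    ‖Av n r τ X‖ ≤ M := by
  have := norm_integral_le_of_norm_le_const (μ := muS n) (f := fun h => τ (X + r • h)) (C := M)
    (Filter.Eventually.of_forall fun h => hM _)
  simpa using! this

lemma bw_scale (n : ℕ) {r : ℝ} (hr : 0 < r) (X Y : En n × En n) :
    bw n (r/2) (X.1 - Y.1) * bw n (r/2) (X.2 - Y.2) = (SB n).indicator (1 : En n × En n → ℂ) (r⁻¹ • (Y - X)) := by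
  have e : ∀ u v : En n, ‖r⁻¹ • (v - u)‖ ≤ 1/2 ↔ ‖u - v‖ ≤ r/2 := by
    intro u v
    rw [norm_smul, norm_sub_rev, Real.norm_of_nonneg (by positivity), inv_mul_le_iff₀ hr, mul_one_div]
  have h1 : (r⁻¹ • (Y - X)) ∈ SB n ↔ (X.1 - Y.1 ∈ Metric.closedBall (0 : En n) (r/2)) ∧
      (X.2 - Y.2 ∈ Metric.closedBall (0 : En n) (r/2)) := by
    rw [SB, mem_closedBall_zero_iff, mem_closedBall_zero_iff, mem_closedBall_zero_iff,
      Prod.norm_def, sup_le_iff, ← e, ← e]; rfl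
  unfold bw
  by_cases a : X.1 - Y.1 ∈ Metric.closedBall (0 : En n) (r/2)
  · by_cases b : X.2 - Y.2 ∈ Metric.closedBall (0 : En n) (r/2)
    · rw [Set.indicator_of_mem a, Set.indicator_of_mem b, Set.indicator_of_mem (h1.2 ⟨a, b⟩)]
      simp
    · rw [Set.indicator_of_notMem b, Set.indicator_of_notMem (fun h => b (h1.1 h).2), mul_zero]
  · rw [Set.indicator_of_notMem a, Set.indicator_of_notMem (fun h => a (h1.1 h).1), zero_mul]

lemma Av_eq (n : ℕ) {r : ℝ} (hr : 0 < r) (τ : En n × En n → ℂ) (X : En n × En n) :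
    Av n r τ X = (((vb n * vb n).toReal⁻¹ * (r ^ (2 * n))⁻¹ : ℝ) : ℂ) *
      ∫ Y, bw n (r/2) (X.1 - Y.1) * bw n (r/2) (X.2 - Y.2) * τ Y := by
  have h1 : Av n r τ X = ((vb n * vb n).toReal⁻¹ : ℝ) • ∫ h, (SB n).indicator (1 : En n × En n → ℂ) h * τ (X + r • h) := by
    unfold Av muS ProbabilityTheory.cond
    rw [integral_smul_measure, SB_vol, ENNReal.toReal_inv, ← integral_indicator (SB_meas n)]
    congr 2; ext h
    by_cases hh : h ∈ SB n <;> simp [hh]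
  have h2 := Measure.integral_comp_smul (volume : Measure (En n × En n))
    (fun u => (SB n).indicator (1 : En n × En n → ℂ) (r⁻¹ • u) * τ (X + u)) r
  have h3 := integral_sub_right_eq_self (μ := (volume : Measure (En n × En n)))
    (fun u => (SB n).indicator (1 : En n × En n → ℂ) (r⁻¹ • u) * τ (X + u)) X
  have hf : Module.finrank ℝ (En n × En n) = 2 * n := by
    rw [Module.finrank_prod]; simp [two_mul]
  rw [hf, ← h3] at h2
  simp only [smul_smul, inv_mul_cancel₀ hr.ne', one_smul, add_sub_cancel] at h2
  rw [h1, h2]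
  simp_rw [bw_scale n hr]
  rw [abs_of_pos (by positivity)]
  simp only [Complex.real_smul]
  push_cast
  ring

lemma vol_ball (n : ℕ) {r : ℝ} (hr : 0 < r) :
    volume (Metric.closedBall (0 : En n) (r/2)) = ENNReal.ofReal (r ^ n) * vb n := by
  have := Measure.addHaar_closedBall_mul (volume : Measure (En n)) (0 : En n) hr.le (s := 1/2) (by norm_num)
  rw [mul_one_div] at this
  rw [this]; simp [vb]

/-- the oscillating tensor -/
def EG (n : ℕ) (g φ : En n → ℂ) (Z : En n × En n) : ℂ :=
  Complex.exp (I * ((⟪Z.1, Z.2⟫ : ℝ) : ℂ)) * (g Z.1 * φ Z.2)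

lemma EG_meas (n : ℕ) (g φ : En n → ℂ) (hg : Measurable g) (hφ : Measurable φ) : Measurable (EG n g φ) := by
  unfold EG
  fun_prop

lemma EG_int (n : ℕ) (g φ : En n → ℂ) (hg1 : Integrable g) (hφ1 : Integrable φ) :
    Integrable (EG n g φ) := by
  have := hg1.mul_prod hφ1
  refine this.bdd_mul (c := 1) ?_ ?_
  · fun_prop
  · exact Filter.Eventually.of_forall fun Z => (norm_expI _).le

lemma opS_pair (n : ℕ) (s : En n × En n → ℂ) (hs : Measurable s) (M : ℝ) (hM : ∀ X, ‖s X‖ ≤ M)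
    (g φ : En n → ℂ) (hg1 : Integrable g) (hφ1 : Integrable φ) :
    ∫ x, opS n s φ x * g x = ∫ Z, s Z * EG n g φ Z := by
  have hi : Integrable (fun Z => s Z * EG n g φ Z) :=
    (EG_int n g φ hg1 hφ1).bdd_mul (c := M) hs.aestronglyMeasurable (Filter.Eventually.of_forall hM)
  rw [Measure.volume_eq_prod] at hi ⊢
  rw [integral_prod _ hi]
  congr 1; ext x
  unfold opS
  rw [← integral_mul_const]
  congr 1; ext ξ
  unfold EG
  ring

lemma Av_pair (n : ℕ) {r : ℝ} (hr : 0 < r) (τ : En n × En n → ℂ) (hτ : Measurable τ) (M : ℝ)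
    (hM : ∀ X, ‖τ X‖ ≤ M)
    (g φ : En n → ℂ) (hg : Measurable g) (hφ : Measurable φ) (hg1 : Integrable g) (hφ1 : Integrable φ) :
    ∫ Z, Av n r τ Z * EG n g φ Z = (((vb n * vb n).toReal⁻¹ * (r ^ (2 * n))⁻¹ : ℝ) : ℂ) *
      ∫ Y, τ Y * HY n (r/2) g φ Y := by
  set W : En n × En n → ℂ := fun U => bw n (r/2) U.1 * bw n (r/2) U.2 with hW
  have hbi : Integrable (bw n (r/2)) := by
    unfold bw
    rw [integrable_indicator_iff Metric.isClosed_closedBall.measurableSet]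
    exact integrableOn_const measure_closedBall_lt_top.ne
  have hWi : Integrable W := hbi.mul_prod hbi
  have hEi := EG_int n g φ hg1 hφ1
  have hWn : ∀ Y Z : En n × En n, W (Y - Z) = W (Z - Y) := by
    intro Y Z
    simp only [hW, Prod.fst_sub, Prod.snd_sub, bw_even n _ Y.1, bw_even n _ Y.2]
  have hI : Integrable (fun p : (En n × En n) × (En n × En n) => EG n g φ p.2 * W (p.1 - p.2))
    (volume.prod volume) := by
    exact Integrable.convolution_integrand (ContinuousLinearMap.mul ℂ ℂ) hEi hWi
  have hI2 : Integrable (fun p : (En n × En n) × (En n × En n) => τ p.1 * (EG n g φ p.2 * W (p.1 - p.2)))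
    (volume.prod volume) := by
    refine hI.bdd_mul (c := M) ?_ (Filter.Eventually.of_forall fun p => hM _)
    exact (hτ.comp measurable_fst).aestronglyMeasurable
  simp_rw [Av_eq n hr, mul_assoc _ _ (EG n g φ _)]
  rw [integral_const_mul]
  congr 1
  have := integral_integral_swap (f := fun Y Z => τ Y * (EG n g φ Z * W (Y - Z))) hI2
  have e1 : ∀ Z : En n × En n, (∫ Y : En n × En n, bw n (r / 2) (Z.1 - Y.1) * bw n (r / 2) (Z.2 - Y.2) * τ Y) * EG n g φ Z
     = ∫ Y, τ Y * (EG n g φ Z * W (Y - Z)) := by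
    intro Z
    rw [← integral_mul_const]
    congr 1; ext Y
    rw [hWn]; simp only [hW, Prod.fst_sub, Prod.snd_sub]; ring
  simp_rw [e1]
  rw [← this]
  congr 1; ext Y
  rw [integral_const_mul]
  congr 1
  unfold HY
  congr 1; ext Z
  rw [hWn]; simp only [hW, EG, Prod.fst_sub, Prod.snd_sub]; ring

/-- the constant of the key estimate -/
def Kn (n : ℕ) : ℝ≥0∞ := Pn n * (vb n)⁻¹ * ENNReal.ofReal (Real.exp (n * (((n:ℝ)+1)/2)^2))

lemma Kn_ne_top (n : ℕ) : Kn n ≠ ⊤ := by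
  unfold Kn Pn
  refine ENNReal.mul_ne_top (ENNReal.mul_ne_top ENNReal.ofReal_ne_top ?_) ENNReal.ofReal_ne_top
  simp [vb_ne_zero]

lemma key (n : ℕ) {r : ℝ} (hr : 0 < r) (hr' : r ≤ n + 1) (τ : En n × En n → ℂ) (hτ : Measurable τ)
    (M : ℝ) (hM0 : 0 ≤ M) (hM : ∀ X, ‖τ X‖ ≤ M) (φ : En n → ℂ) (hφ : Measurable φ)
    (hφ1 : Integrable φ) (hφ2 : MemLp φ 2) :
    (∫⁻ x, ‖opS n (Av n r τ) φ x‖ₑ ^ 2) ^ (1/2 : ℝ) ≤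
      Kn n * ENNReal.ofReal (M * (r ^ n)⁻¹) * (∫⁻ x, ‖φ x‖ₑ ^ 2) ^ (1/2 : ℝ) := by
  refine duality n _ (meas_opS n _ φ (Av_meas n r τ hτ) hφ) _
    (opS_bdd n _ φ M (Av_bdd n r τ M hM) hφ1) _ ?_
  intro g hg hg1 hg2
  rw [opS_pair n _ (Av_meas n r τ hτ) M (Av_bdd n r τ M hM) g φ hg1 hφ1,
    Av_pair n hr τ hτ M hM g φ hg hφ hg1 hφ1, enorm_mul]
  have h1 : ‖∫ Y, τ Y * HY n (r/2) g φ Y‖ₑ ≤ ENNReal.ofReal M * ∫⁻ Y, ‖HY n (r/2) g φ Y‖ₑ := by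
    refine (enorm_integral_le_lintegral_enorm _).trans ?_
    rw [← lintegral_const_mul' _ _ ENNReal.ofReal_ne_top]
    refine lintegral_mono fun Y => ?_
    rw [enorm_mul]
    gcongr
    rw [← ofReal_norm]
    exact ENNReal.ofReal_le_ofReal (hM Y)
  have h2 := HY_int n (r/2) (by positivity) g φ hg hφ hg1 hφ1 hg2 hφ2
  rw [vol_ball n hr] at h2
  have h3 : ENNReal.ofReal (Real.exp (n * (r/2)^2)) ≤ ENNReal.ofReal (Real.exp (n * (((n:ℝ)+1)/2)^2)) := by
    gcongr
  have h4 : ‖(((vb n * vb n).toReal⁻¹ * (r ^ (2 * n))⁻¹ : ℝ) : ℂ)‖ₑ =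
      (vb n)⁻¹ * (vb n)⁻¹ * ENNReal.ofReal ((r^(2*n))⁻¹) := by
    rw [← ofReal_norm, Complex.norm_real, Real.norm_of_nonneg (by positivity),
      ENNReal.ofReal_mul (by positivity), ENNReal.ofReal_inv_of_pos, ENNReal.ofReal_toReal,
      ENNReal.mul_inv]
    · simp [vb_ne_zero]
    · simp [vb_ne_zero]
    · exact ENNReal.mul_ne_top (vb_ne_top n) (vb_ne_top n)
    · exact ENNReal.toReal_pos (by simp [vb_ne_zero]) (ENNReal.mul_ne_top (vb_ne_top n) (vb_ne_top n))
  have h5 : ENNReal.ofReal ((r^(2*n))⁻¹) * ENNReal.ofReal (r^n) = ENNReal.ofReal ((r^n)⁻¹) := by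
    rw [← ENNReal.ofReal_mul (by positivity)]
    congr 1
    rw [two_mul, pow_add]
    field_simp
  have h6 : (vb n)⁻¹ * vb n = 1 := ENNReal.inv_mul_cancel (vb_ne_zero n) (vb_ne_top n)
  rw [h4]
  set a := (∫⁻ x, ‖g x‖ₑ ^ 2) ^ (1/2 : ℝ)
  set b := (∫⁻ x, ‖φ x‖ₑ ^ 2) ^ (1/2 : ℝ)
  calc _ ≤ (vb n)⁻¹ * (vb n)⁻¹ * ENNReal.ofReal ((r^(2*n))⁻¹) * (ENNReal.ofReal M *
        (Pn n * (ENNReal.ofReal (r ^ n) * vb n) * ENNReal.ofReal (Real.exp (n * (((n:ℝ)+1)/2)^2)) * (a * b))) := by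
        refine mul_le_mul_right (h1.trans (mul_le_mul_right (h2.trans ?_) _)) _
        gcongr
    _ = ((vb n)⁻¹ * vb n) * (ENNReal.ofReal ((r^(2*n))⁻¹) * ENNReal.ofReal (r^n)) * (Pn n * (vb n)⁻¹ * ENNReal.ofReal (Real.exp (n * (((n:ℝ)+1)/2)^2))) * ENNReal.ofReal M * b * a := by ring
    _ = _ := by
      rw [h5, h6, ENNReal.ofReal_mul hM0, Kn]
      ring

/-- bounded measurable symbols -/
def BM {n : ℕ} (τ : En n × En n → ℂ) : Prop := Measurable τ ∧ ∃ M : ℝ, ∀ X, ‖τ X‖ ≤ M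

lemma BM_int {n : ℕ} {τ : En n × En n → ℂ} (h : BM τ) (X : En n × En n) (r : ℝ) :
    Integrable (fun h => τ (X + r • h)) (muS n) := by
  obtain ⟨hm, M, hM⟩ := h
  refine memLp_one_iff_integrable.1 (MemLp.of_bound (C := M) ?_ (Filter.Eventually.of_forall fun x => hM _))
  exact (hm.comp (by fun_prop)).aestronglyMeasurable

lemma BM.av {n : ℕ} {τ : En n × En n → ℂ} (h : BM τ) (r : ℝ) : BM (Av n r τ) :=
  ⟨Av_meas n r τ h.1, h.2.imp fun M hM => Av_bdd n r τ M hM⟩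

lemma BM.sub {n : ℕ} {τ τ' : En n × En n → ℂ} (h : BM τ) (h' : BM τ') : BM (τ - τ') := by
  obtain ⟨M, hM⟩ := h.2
  obtain ⟨M', hM'⟩ := h'.2
  exact ⟨h.1.sub h'.1, M + M', fun X => (norm_sub_le _ _).trans (add_le_add (hM X) (hM' X))⟩

lemma BM.add {n : ℕ} {τ τ' : En n × En n → ℂ} (h : BM τ) (h' : BM τ') : BM (τ + τ') := by
  obtain ⟨M, hM⟩ := h.2
  obtain ⟨M', hM'⟩ := h'.2
  exact ⟨h.1.add h'.1, M + M', fun X => (norm_add_le _ _).trans (add_le_add (hM X) (hM' X))⟩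

lemma Av_sub {n : ℕ} {τ τ' : En n × En n → ℂ} (h : BM τ) (h' : BM τ') (r : ℝ) :
    Av n r (τ - τ') = Av n r τ - Av n r τ' := by
  ext X
  exact integral_sub (BM_int h X r) (BM_int h' X r)

lemma Av_comm {n : ℕ} {τ : En n × En n → ℂ} (h : BM τ) (r s : ℝ) :
    Av n r (Av n s τ) = Av n s (Av n r τ) := by
  ext X
  unfold Av
  have := integral_integral_swap (μ := muS n) (ν := muS n) (f := fun h k => τ (X + r • h + s • k)) ?_
  · rw [this]
    simp_rw [add_right_comm]
  · obtain ⟨hm, M, hM⟩ := h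
    refine memLp_one_iff_integrable.1 (MemLp.of_bound (C := M) ?_ (Filter.Eventually.of_forall fun x => hM _))
    exact (hm.comp (by fun_prop)).aestronglyMeasurable

/-- coefficients -/
def cf (n m : ℕ) : ℂ := (-1) ^ m * ((n+1).choose (m+1) : ℂ)

/-- high order averaging -/
def Sm (n : ℕ) (l : ℝ) (τ : En n × En n → ℂ) (X : En n × En n) : ℂ :=
  ∑ m ∈ Finset.range (n+1), cf n m * Av n ((m + 1 : ℕ) * l) τ X

/-- sum of the absolute values of coefficients -/
def Dn (n : ℕ) : ℝ := ∑ m ∈ Finset.range (n+1), ‖cf n m‖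

lemma Dn_nonneg (n : ℕ) : 0 ≤ Dn n := Finset.sum_nonneg fun _ _ => norm_nonneg _

lemma Sm_bdd (n : ℕ) (l : ℝ) (τ : En n × En n → ℂ) (M : ℝ) (hM : ∀ X, ‖τ X‖ ≤ M) (X) :
    ‖Sm n l τ X‖ ≤ Dn n * M := by
  unfold Sm Dn
  rw [Finset.sum_mul]
  refine (norm_sum_le _ _).trans (Finset.sum_le_sum fun m _ => ?_)
  rw [norm_mul]
  gcongr
  exact Av_bdd n _ τ M hM X

lemma BM.sm {n : ℕ} {τ : En n × En n → ℂ} (h : BM τ) (l : ℝ) : BM (Sm n l τ) := by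
  refine ⟨?_, ?_⟩
  · unfold Sm
    exact Finset.measurable_fun_sum _ fun m _ => (Av_meas n _ τ h.1).const_mul _
  · obtain ⟨M, hM⟩ := h.2
    exact ⟨_, Sm_bdd n l τ M hM⟩

lemma Sm_sub {n : ℕ} {τ τ' : En n × En n → ℂ} (h : BM τ) (h' : BM τ') (l : ℝ) :
    Sm n l (τ - τ') = Sm n l τ - Sm n l τ' := by
  ext X
  simp only [Sm, Pi.sub_apply, ← Finset.sum_sub_distrib, Av_sub h h', mul_sub]

lemma Av_Sm {n : ℕ} {τ : En n × En n → ℂ} (h : BM τ) (r l : ℝ) (X : En n × En n) :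
    Av n r (Sm n l τ) X = ∑ m ∈ Finset.range (n+1), cf n m * Av n r (Av n ((m + 1 : ℕ) * l) τ) X := by
  have : Av n r (Sm n l τ) X = ∫ h, ∑ m ∈ Finset.range (n+1), cf n m * Av n ((m + 1 : ℕ) * l) τ (X + r • h) ∂(muS n) := rfl
  rw [this, integral_finsetSum]
  · refine Finset.sum_congr rfl fun m _ => ?_
    rw [integral_const_mul]; rfl
  · intro m _
    exact (BM_int (h.av _) X r).const_mul _

lemma Sm_comm {n : ℕ} {τ : En n × En n → ℂ} (h : BM τ) (l l' : ℝ) :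
    Sm n l (Sm n l' τ) = Sm n l' (Sm n l τ) := by
  ext X
  have e : ∀ l l', Sm n l (Sm n l' τ) X = ∑ m ∈ Finset.range (n+1), ∑ k ∈ Finset.range (n+1),
      cf n m * (cf n k * Av n ((m + 1 : ℕ) * l) (Av n ((k + 1 : ℕ) * l') τ) X) := by
    intro l l'
    rw [Sm]
    refine Finset.sum_congr rfl fun m _ => ?_
    rw [Av_Sm h, Finset.mul_sum]
  rw [e, e, Finset.sum_comm]
  refine Finset.sum_congr rfl fun m _ => Finset.sum_congr rfl fun k _ => ?_
  rw [Av_comm h]; ring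

lemma idiff_sum {n : ℕ} (τ : En n × En n → ℂ) (h X : En n × En n) :
    (-1) ^ (n+1) * (idiff h)^[n+1] τ X =
      τ X - ∑ m ∈ Finset.range (n+1), cf n m * τ (X + ((m+1 : ℕ) : ℝ) • h) := by
  have h1 : (idiff h : (En n × En n → ℂ) → _) = fwdDiff h := rfl
  rw [h1, fwdDiff_iter_eq_sum_shift, Finset.sum_range_succ', mul_add, Finset.mul_sum, add_comm,
    sub_eq_add_neg, ← Finset.sum_neg_distrib]
  congr 1
  · simp [← mul_assoc, ← pow_add]
  · refine Finset.sum_congr rfl fun m hm => ?_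
    have hm' : m ≤ n := by simpa [Nat.lt_succ_iff] using hm
    obtain ⟨k, rfl⟩ := Nat.exists_eq_add_of_le hm'
    have h2 : m + k + 1 - (m + 1) = k := by omega
    rw [h2, Nat.cast_smul_eq_nsmul ℝ, cf]
    simp only [zsmul_eq_mul]
    push_cast
    have h3 : ((-1 : ℂ)) ^ (m + k + 1) * (-1)^k = - (-1)^m := by
      rw [← pow_add, show m + k + 1 + k = m + 1 + 2 * k by ring, pow_add, pow_mul]
      simp [pow_succ]
    rw [← mul_assoc, ← mul_assoc, h3]
    ring

lemma sub_Sm {n : ℕ} {τ : En n × En n → ℂ} (hτ : BM τ) (l : ℝ) (X : En n × En n) :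
    τ X - Sm n l τ X = ∫ h, (-1) ^ (n+1) * (idiff (l • h))^[n+1] τ X ∂(muS n) := by
  simp_rw [idiff_sum, smul_smul]
  rw [integral_sub (integrable_const _), integral_finsetSum]
  · simp_rw [integral_const_mul]
    simp [Sm, Av]
  · intro m _
    exact (BM_int hτ X _).const_mul _
  · refine integrable_finsetSum _ fun m _ => (BM_int hτ X _).const_mul _

lemma sub_Sm_bdd {n : ℕ} {τ : En n × En n → ℂ} (hτ : BM τ) {l : ℝ} (hl : 0 ≤ l) (w : ℝ) (hw0 : 0 ≤ w)
    (hw : ∀ h, 0 < pnorm2 n h → pnorm2 n h ≤ l → ∀ X, ‖(idiff h)^[n+1] τ X‖ ≤ w) (X : En n × En n) :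
    ‖τ X - Sm n l τ X‖ ≤ w := by
  rw [sub_Sm hτ]
  have := norm_integral_le_of_norm_le_const (μ := muS n)
    (f := fun h => (-1) ^ (n+1) * (idiff (l • h))^[n+1] τ X) (C := w) ?_
  · simpa using! this
  have hae : ∀ᵐ h ∂(muS n), h ∈ SB n := ProbabilityTheory.ae_cond_mem (SB_meas n)
  filter_upwards [hae] with h hh
  rw [norm_mul, norm_pow, norm_neg, norm_one, one_pow, one_mul]
  have hb : ‖h.1‖ ≤ 1/2 ∧ ‖h.2‖ ≤ 1/2 := by
    rw [SB, mem_closedBall_zero_iff, Prod.norm_def, sup_le_iff] at hh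
    exact hh
  rcases (Real.sqrt_nonneg (‖(l • h).1‖ ^ 2 + ‖(l • h).2‖ ^ 2)).eq_or_lt with h0 | h0
  · have : l • h = 0 := by
      rw [eq_comm, Real.sqrt_eq_zero (by positivity)] at h0
      have a : ‖(l • h).1‖ = 0 := by nlinarith [sq_nonneg ‖(l • h).1‖, sq_nonneg ‖(l • h).2‖]
      have b : ‖(l • h).2‖ = 0 := by nlinarith [sq_nonneg ‖(l • h).1‖, sq_nonneg ‖(l • h).2‖]
      exact Prod.ext (norm_eq_zero.1 a) (norm_eq_zero.1 b)
    rw [this, Function.iterate_succ_apply', idiff]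
    simpa using hw0
  · refine hw _ h0 ?_ X
    rw [pnorm2, Real.sqrt_le_left hl, Prod.smul_fst, Prod.smul_snd, norm_smul, norm_smul,
      Real.norm_of_nonneg hl, mul_pow, mul_pow]
    have h1 : ‖h.1‖^2 ≤ 1/4 := by nlinarith [norm_nonneg h.1, hb.1]
    have h2 : ‖h.2‖^2 ≤ 1/4 := by nlinarith [norm_nonneg h.2, hb.2]
    nlinarith [sq_nonneg l]

/-- iterated smoothing at dyadic scale -/
def TT (n : ℕ) (τ : En n × En n → ℂ) (J : ℕ) : En n × En n → ℂ :=
  Sm n ((1/2)^J) (Sm n ((1/2)^J) τ)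

/-- dyadic difference -/
def dj (n : ℕ) (τ : En n × En n → ℂ) (j : ℕ) : En n × En n → ℂ :=
  Sm n ((1/2)^(j+1)) τ - Sm n ((1/2)^j) τ

lemma TT_succ {n : ℕ} {τ : En n × En n → ℂ} (hτ : BM τ) (J : ℕ) :
    TT n τ (J+1) = TT n τ J + (Sm n ((1/2)^(J+1)) (dj n τ J) + Sm n ((1/2)^J) (dj n τ J)) := by
  unfold TT dj
  rw [Sm_sub (hτ.sm _) (hτ.sm _), Sm_sub (hτ.sm _) (hτ.sm _), Sm_comm hτ ((1/2)^(J+1)) ((1/2)^J)]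
  abel

lemma eL2 {n : ℕ} (g : En n → ℂ) : eLpNorm g 2 volume = (∫⁻ x, ‖g x‖ₑ ^ 2) ^ (1/2 : ℝ) := by
  rw [eLpNorm_eq_lintegral_rpow_enorm_toReal (by norm_num) (by norm_num)]
  simp

lemma opS_integrable {n : ℕ} {s : En n × En n → ℂ} (hs : BM s) {φ : En n → ℂ}
    (h1 : Integrable φ) (x : En n) :
    Integrable (fun ξ : En n => Complex.exp (I * ((⟪x, ξ⟫ : ℝ) : ℂ)) * s (x, ξ) * φ ξ) := by
  obtain ⟨hm, M, hM⟩ := hs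
  refine h1.bdd_mul (c := M) ?_ (Filter.Eventually.of_forall fun ξ => ?_)
  · apply Measurable.aestronglyMeasurable
    have := hm.comp (measurable_prodMk_left (x := x))
    exact Measurable.mul (by fun_prop) this
  · rw [norm_mul, norm_expI, one_mul]; exact hM _

lemma opS_add {n : ℕ} {s t : En n × En n → ℂ} (hs : BM s) (ht : BM t) {φ : En n → ℂ}
    (h1 : Integrable φ) : opS n (s + t) φ = opS n s φ + opS n t φ := by
  ext x
  rw [Pi.add_apply]
  unfold opS
  rw [← integral_add (opS_integrable hs h1 x) (opS_integrable ht h1 x)]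
  congr 1; ext ξ
  simp only [Pi.add_apply]; ring

lemma opS_sub {n : ℕ} {s t : En n × En n → ℂ} (hs : BM s) (ht : BM t) {φ : En n → ℂ}
    (h1 : Integrable φ) : opS n (s - t) φ = opS n s φ - opS n t φ := by
  ext x
  rw [Pi.sub_apply]
  unfold opS
  rw [← integral_sub (opS_integrable hs h1 x) (opS_integrable ht h1 x)]
  congr 1; ext ξ
  simp only [Pi.sub_apply]; ring

lemma opS_Sm {n : ℕ} {τ : En n × En n → ℂ} (hs : BM τ) {φ : En n → ℂ}
    (h1 : Integrable φ) (l : ℝ) : opS n (Sm n l τ) φ =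
      ∑ m ∈ Finset.range (n+1), cf n m • opS n (Av n ((m + 1 : ℕ) * l) τ) φ := by
  ext x
  rw [Finset.sum_apply]
  have : opS n (Sm n l τ) φ x = ∫ ξ, ∑ m ∈ Finset.range (n+1), cf n m *
    (Complex.exp (I * ((⟪x, ξ⟫ : ℝ) : ℂ)) * Av n ((m + 1 : ℕ) * l) τ (x, ξ) * φ ξ) := by
    unfold opS
    congr 1; ext ξ
    rw [Sm, Finset.mul_sum, Finset.sum_mul]
    refine Finset.sum_congr rfl fun m _ => by ring
  rw [this, integral_finsetSum]
  · refine Finset.sum_congr rfl fun m _ => ?_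
    rw [integral_const_mul]; rfl
  · intro m _
    exact (opS_integrable (hs.av _) h1 x).const_mul _

lemma key2 {n : ℕ} {l : ℝ} (hl : 0 < l) (hl1 : l ≤ 1) (τ : En n × En n → ℂ) (hτ : Measurable τ)
    (M : ℝ) (hM0 : 0 ≤ M) (hM : ∀ X, ‖τ X‖ ≤ M) (φ : En n → ℂ) (hφ : Measurable φ)
    (hφ1 : Integrable φ) (hφ2 : MemLp φ 2) :
    eLpNorm (opS n (Sm n l τ) φ) 2 volume ≤
      ENNReal.ofReal (Dn n) * Kn n * ENNReal.ofReal (M * (l ^ n)⁻¹) * eLpNorm φ 2 volume := by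
  have hB : BM τ := ⟨hτ, M, hM⟩
  rw [opS_Sm hB hφ1]
  refine (eLpNorm_sum_le (fun m _ => ?_) (by norm_num)).trans ?_
  · exact ((meas_opS n _ φ (hB.av _).1 hφ).const_smul _).aestronglyMeasurable
  rw [Dn, ENNReal.ofReal_sum_of_nonneg (fun _ _ => norm_nonneg _), Finset.sum_mul, Finset.sum_mul,
    Finset.sum_mul]
  refine Finset.sum_le_sum fun m hm => ?_
  rw [eLpNorm_const_smul, eL2, eL2, ofReal_norm, mul_assoc, mul_assoc]
  have hm' : m ≤ n := by simpa [Nat.lt_succ_iff] using hm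
  have hmn : ((m + 1 : ℕ) : ℝ) ≤ n + 1 := by exact_mod_cast Nat.succ_le_succ hm'
  have hm1 : (1 : ℝ) ≤ ((m + 1 : ℕ) : ℝ) := by push_cast; linarith [(Nat.cast_nonneg m : (0:ℝ) ≤ m)]
  refine mul_le_mul_right ((key n (by positivity) ?_ τ hτ M hM0 hM φ hφ hφ1 hφ2).trans ?_) _
  · nlinarith
  · rw [mul_assoc]
    gcongr
    nlinarith

lemma TT_BM {n : ℕ} {τ : En n × En n → ℂ} (hτ : BM τ) (J : ℕ) : BM (TT n τ J) := (hτ.sm _).sm _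

lemma dj_BM {n : ℕ} {τ : En n × En n → ℂ} (hτ : BM τ) (J : ℕ) : BM (dj n τ J) := (hτ.sm _).sub (hτ.sm _)

lemma TT_bound {n : ℕ} {σ : En n × En n → ℂ} (hσ : Measurable σ) (M : ℝ) (hM0 : 0 ≤ M)
    (hM : ∀ X, ‖σ X‖ ≤ M) (w : ℕ → ℝ) (hw0 : ∀ j, 0 ≤ w j)
    (hw : ∀ j X, ‖σ X - Sm n ((1/2)^j) σ X‖ ≤ w j)
    (φ : En n → ℂ) (hφ : Measurable φ) (hφ1 : Integrable φ) (hφ2 : MemLp φ 2) (J : ℕ) :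
    eLpNorm (opS n (TT n σ J) φ) 2 volume ≤ ENNReal.ofReal (Dn n) * Kn n *
      (ENNReal.ofReal (Dn n * M) + ∑ j ∈ Finset.range J,
        2 * ENNReal.ofReal ((w (j+1) + w j) * 2 ^ ((j+1) * n))) * eLpNorm φ 2 volume := by
  have hB : BM σ := ⟨hσ, M, hM⟩
  induction J with
  | zero =>
    have := key2 (n := n) (l := 1) one_pos le_rfl (Sm n 1 σ) (hB.sm _).1 (Dn n * M)
      (mul_nonneg (Dn_nonneg n) hM0) (Sm_bdd n 1 σ M hM) φ hφ hφ1 hφ2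
    simpa [TT] using this
  | succ J ih =>
    have hd : ∀ X, ‖dj n σ J X‖ ≤ w (J+1) + w J := by
      intro X
      have : dj n σ J X = (σ X - Sm n ((1/2)^J) σ X) - (σ X - Sm n ((1/2)^(J+1)) σ X) := by
        simp only [dj, Pi.sub_apply]; ring
      rw [this, add_comm (w (J+1))]
      exact (norm_sub_le _ _).trans (add_le_add (hw _ _) (hw _ _))
    have hk : ∀ k, k ≤ J + 1 → eLpNorm (opS n (Sm n ((1/2)^k) (dj n σ J)) φ) 2 volume ≤
        ENNReal.ofReal (Dn n) * Kn n * ENNReal.ofReal ((w (J+1) + w J) * 2 ^ ((J+1) * n)) * eLpNorm φ 2 volume := by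
      intro k hk
      refine (key2 (n := n) (l := (1/2)^k) (by positivity) (pow_le_one₀ (by norm_num) (by norm_num))
        (dj n σ J) (dj_BM hB J).1 (w (J+1) + w J) (add_nonneg (hw0 _) (hw0 _)) hd φ hφ hφ1 hφ2).trans ?_
      have : (((1/2 : ℝ)^k) ^ n)⁻¹ ≤ 2 ^ ((J+1) * n) := by
        rw [← pow_mul, one_div, inv_pow, inv_inv]
        exact pow_le_pow_right₀ (by norm_num) (Nat.mul_le_mul_right _ hk)
      have := mul_le_mul_of_nonneg_left this (add_nonneg (hw0 (J+1)) (hw0 J))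
      gcongr
    have m1 := fun k => (meas_opS n _ φ ((dj_BM hB J).sm ((1/2)^k)).1 hφ).aestronglyMeasurable (μ := volume)
    rw [TT_succ hB, opS_add (TT_BM hB J) (((dj_BM hB J).sm _).add ((dj_BM hB J).sm _)) hφ1,
      opS_add ((dj_BM hB J).sm _) ((dj_BM hB J).sm _) hφ1, Finset.sum_range_succ]
    refine (eLpNorm_add_le (meas_opS n _ φ (TT_BM hB J).1 hφ).aestronglyMeasurable
      ((m1 _).add (m1 _)) (by norm_num)).trans ?_
    refine (add_le_add ih ((eLpNorm_add_le (m1 _) (m1 _) (by norm_num)).trans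
      (add_le_add (hk (J+1) le_rfl) (hk J (Nat.le_succ J))))).trans (le_of_eq ?_)
    ring

lemma TT_close {n : ℕ} {σ : En n × En n → ℂ} (hB : BM σ) (w : ℝ) (J : ℕ)
    (hw : ∀ X, ‖σ X - Sm n ((1/2)^J) σ X‖ ≤ w) (X : En n × En n) :
    ‖(σ - TT n σ J) X‖ ≤ (1 + Dn n) * w := by
  have h1 := Sm_bdd n ((1/2)^J) (σ - Sm n ((1/2)^J) σ) w hw X
  rw [Sm_sub hB (hB.sm _)] at h1
  have : (σ - TT n σ J) X = (σ X - Sm n ((1/2)^J) σ X) + (Sm n ((1/2)^J) σ - Sm n ((1/2)^J) (Sm n ((1/2)^J) σ)) X := by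
    simp [TT]
  rw [this, add_mul, one_mul]
  exact (norm_add_le _ _).trans (add_le_add (hw X) h1)

lemma main_bound {n : ℕ} {σ : En n × En n → ℂ} (hσ : Measurable σ) (M : ℝ) (hM0 : 0 ≤ M)
    (hM : ∀ X, ‖σ X‖ ≤ M) (w : ℕ → ℝ) (hw0 : ∀ j, 0 ≤ w j)
    (hw : ∀ j X, ‖σ X - Sm n ((1/2)^j) σ X‖ ≤ w j)
    (hlim : Filter.Tendsto w Filter.atTop (nhds 0))
    (φ : En n → ℂ) (hφ : Measurable φ) (hφ1 : Integrable φ) (hφ2 : MemLp φ 2) :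
    eLpNorm (opS n σ φ) 2 volume ≤ ENNReal.ofReal (Dn n) * Kn n *
      (ENNReal.ofReal (Dn n * M) + ∑' j : ℕ,
        2 * ENNReal.ofReal ((w (j+1) + w j) * 2 ^ ((j+1) * n))) * eLpNorm φ 2 volume := by
  have hB : BM σ := ⟨hσ, M, hM⟩
  refine (Lp.eLpNorm_lim_le_liminf_eLpNorm (f := fun J => opS n (TT n σ J) φ)
    (fun J => (meas_opS n _ φ (TT_BM hB J).1 hφ).aestronglyMeasurable) (opS n σ φ) ?_).trans ?_
  · refine Filter.Eventually.of_forall fun x => ?_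
    rw [tendsto_iff_norm_sub_tendsto_zero]
    have hb : ∀ J, ‖opS n (TT n σ J) φ x - opS n σ φ x‖ ≤ ((1 + Dn n) * w J) * ∫ ξ, ‖φ ξ‖ := by
      intro J
      have := opS_bdd n (σ - TT n σ J) φ _ (TT_close hB (w J) J (hw J)) hφ1 x
      rw [opS_sub hB (TT_BM hB J) hφ1, Pi.sub_apply] at this
      rwa [norm_sub_rev]
    refine squeeze_zero (fun _ => norm_nonneg _) hb ?_
    simpa using (hlim.const_mul (1 + Dn n)).mul_const (∫ ξ, ‖φ ξ‖)
  · refine Filter.liminf_le_of_frequently_le' (Filter.Frequently.of_forall fun J => ?_)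
    refine (TT_bound hσ M hM0 hM w hw0 hw φ hφ hφ1 hφ2 J).trans ?_
    gcongr
    exact ENNReal.sum_le_tsum _

open FourierTransform in
lemma ftI_eq (n : ℕ) (f : En n → ℂ) (ξ : En n) : ftI n f ξ = 𝓕 f ((2 * Real.pi)⁻¹ • ξ) := by
  have := ft_eq n f (-ξ)
  rw [neg_smul_neg] at this
  rw [← this]
  unfold ftI
  congr 1; ext x
  rw [inner_neg_left, real_inner_comm]
  push_cast
  rw [mul_neg]

lemma ftI_l2 (n : ℕ) (f : SchwartzMap (En n) ℂ) :
    ∫⁻ ξ, ‖ftI n f ξ‖ₑ ^ 2 = Pn n * ∫⁻ x, ‖f x‖ₑ ^ 2 := by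
  rw [← planch n f f.integrable (f.memLp 2)]
  rw [← lintegral_neg_eq_self]
  congr 1; ext ξ
  congr 2
  unfold ftI
  congr 1; ext x
  rw [inner_neg_right, real_inner_comm]
  push_cast
  rw [mul_neg, neg_neg]

open FourierTransform in
lemma ftI_cont (n : ℕ) (f : SchwartzMap (En n) ℂ) : Continuous (ftI n f) := by
  have : ftI n f = fun ξ => (𝓕 f : SchwartzMap (En n) ℂ) ((2 * Real.pi)⁻¹ • ξ) := by
    ext ξ; rw [ftI_eq, SchwartzMap.fourier_coe]
  rw [this]
  exact (𝓕 f : SchwartzMap (En n) ℂ).continuous.comp (by fun_prop)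

open FourierTransform in
lemma ftI_int (n : ℕ) (f : SchwartzMap (En n) ℂ) : Integrable (ftI n f) := by
  have : ftI n f = fun ξ => (𝓕 f : SchwartzMap (En n) ℂ) ((2 * Real.pi)⁻¹ • ξ) := by
    ext ξ; rw [ftI_eq, SchwartzMap.fourier_coe]
  rw [this]
  exact (𝓕 f : SchwartzMap (En n) ℂ).integrable.comp_smul (by positivity)

lemma ftI_eLp (n : ℕ) (f : SchwartzMap (En n) ℂ) :
    eLpNorm (ftI n f) 2 volume = Pn n ^ (1/2 : ℝ) * eLpNorm f 2 volume := by
  rw [eL2, eL2, ftI_l2, ENNReal.mul_rpow_of_nonneg _ _ (by norm_num)]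

lemma ftI_memLp (n : ℕ) (f : SchwartzMap (En n) ℂ) : MemLp (ftI n f) 2 := by
  refine ⟨(ftI_cont n f).aestronglyMeasurable, ?_⟩
  have h0 : MemLp f 2 volume := f.memLp 2
  have h1 : eLpNorm f 2 volume < ⊤ := h0.eLpNorm_lt_top
  have h2 : Pn n ^ (1/2 : ℝ) < ⊤ := ENNReal.rpow_lt_top_of_nonneg (by norm_num) (by simp [Pn])
  rw [ftI_eLp]
  exact ENNReal.mul_lt_top h2 h1

/-- If the bounded continuous symbol `σ` on `ℝⁿ × ℝⁿ ≅ ℝ^{2n}` belongs to `B^{n,1}_∞(ℝ^{2n})`,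
i.e. `∑_{j≥0} 2^{jn} sup_{0<|h|≤2^{−j}} ‖Δ_h^{n+1} σ‖_∞ < ∞`, then the symbol operator
`σ(x,D) f(x) = ∫ e^{i x·ξ} σ(x,ξ) f̂(ξ) dξ` is bounded from `L²(ℝⁿ)` to `L²(ℝⁿ)`. -/
theorem stmt_6 (n : ℕ) (hn : 1 ≤ n) (σ : En n × En n → ℂ)
    (hcont : Continuous σ) (hbdd : ∃ M : ℝ, ∀ X : En n × En n, ‖σ X‖ ≤ M)
    (hB : (∑' j : ℕ, (2 : ℝ≥0∞) ^ (j * n) *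
        ⨆ (h : En n × En n) (_ : 0 < pnorm2 n h ∧ pnorm2 n h ≤ (2 : ℝ) ^ (-(j : ℝ))),
          ⨆ X : En n × En n, (‖(idiff h)^[n + 1] σ X‖₊ : ℝ≥0∞)) ≠ ⊤) :
    ∃ C : ℝ, ∀ f : SchwartzMap (En n) ℂ,
      eLpNorm (fun x : En n => ∫ ξ : En n,
          Complex.exp (Complex.I * ((⟪x, ξ⟫ : ℝ) : ℂ)) * σ (x, ξ) * ftI n (⇑f) ξ) 2 volume ≤
        ENNReal.ofReal C * eLpNorm (⇑f) 2 volume := by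
  obtain ⟨M, hM⟩ := hbdd
  have hM0 : 0 ≤ M := (norm_nonneg _).trans (hM 0)
  set Ω : ℕ → ℝ≥0∞ := fun j =>
    ⨆ (h : En n × En n) (_ : 0 < pnorm2 n h ∧ pnorm2 n h ≤ (2 : ℝ) ^ (-(j : ℝ))),
          ⨆ X : En n × En n, (‖(idiff h)^[n + 1] σ X‖₊ : ℝ≥0∞) with hΩ
  have hB' : (∑' j : ℕ, (2 : ℝ≥0∞) ^ (j * n) * Ω j) ≠ ⊤ := hB
  have hle : ∀ j, Ω j ≤ (2 : ℝ≥0∞) ^ (j * n) * Ω j := fun j =>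
    le_mul_of_one_le_left' (one_le_pow₀ (by norm_num))
  have hfin : ∀ j, Ω j ≠ ⊤ := fun j =>
    ne_top_of_le_ne_top (ENNReal.ne_top_of_tsum_ne_top hB' j) (hle j)
  have hσ : BM σ := ⟨hcont.measurable, M, hM⟩
  have hw : ∀ j X, ‖σ X - Sm n ((1/2)^j) σ X‖ ≤ (Ω j).toReal := by
    intro j
    refine sub_Sm_bdd hσ (by positivity) _ ENNReal.toReal_nonneg ?_
    intro h h0 h1 X
    have h2 : pnorm2 n h ≤ (2 : ℝ) ^ (-(j : ℝ)) := by
      rw [Real.rpow_neg (by norm_num), Real.rpow_natCast, ← inv_pow, ← one_div]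
      exact h1
    have h3 : (‖(idiff h)^[n + 1] σ X‖₊ : ℝ≥0∞) ≤ Ω j :=
      le_iSup₂_of_le h ⟨h0, h2⟩ (le_iSup (fun X => (‖(idiff h)^[n + 1] σ X‖₊ : ℝ≥0∞)) X)
    have h4 := ENNReal.toReal_mono (hfin j) h3
    simpa using h4
  have hlim0 : Filter.Tendsto Ω Filter.atTop (nhds 0) :=
    tendsto_of_tendsto_of_tendsto_of_le_of_le tendsto_const_nhds
      (ENNReal.tendsto_atTop_zero_of_tsum_ne_top hB') (fun _ => zero_le) hle
  have hlim : Filter.Tendsto (fun j => (Ω j).toReal) Filter.atTop (nhds 0) := by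
    have h := (ENNReal.tendsto_toReal ENNReal.zero_ne_top).comp hlim0
    rw [ENNReal.toReal_zero] at h
    exact h
  set Q : ℝ≥0∞ := ∑' j : ℕ,
    2 * ENNReal.ofReal (((Ω (j+1)).toReal + (Ω j).toReal) * 2 ^ ((j+1) * n)) with hQ
  have hQfin : Q ≠ ⊤ := by
    have e : ∀ j : ℕ, 2 * ENNReal.ofReal (((Ω (j+1)).toReal + (Ω j).toReal) * 2 ^ ((j+1) * n)) =
        2 * ((2 : ℝ≥0∞) ^ ((j+1) * n) * Ω (j+1)) + 2 * 2 ^ n * ((2 : ℝ≥0∞) ^ (j * n) * Ω j) := by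
      intro j
      rw [ENNReal.ofReal_mul (by positivity), ENNReal.ofReal_add (by positivity) (by positivity),
        ENNReal.ofReal_toReal (hfin _), ENNReal.ofReal_toReal (hfin _),
        ENNReal.ofReal_pow (by norm_num), ENNReal.ofReal_ofNat, add_mul j 1 n, one_mul, pow_add]
      ring
    rw [hQ]
    simp_rw [e]
    rw [ENNReal.tsum_add, ENNReal.tsum_mul_left, ENNReal.tsum_mul_left]
    refine ENNReal.add_ne_top.2 ⟨ENNReal.mul_ne_top (by norm_num) ?_,
      ENNReal.mul_ne_top (ENNReal.mul_ne_top (by norm_num) (ENNReal.pow_ne_top (by norm_num))) hB'⟩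
    refine ne_top_of_le_ne_top hB' ?_
    exact ENNReal.tsum_comp_le_tsum_of_injective (add_left_injective 1)
      (fun j => (2 : ℝ≥0∞) ^ (j * n) * Ω j)
  set K : ℝ≥0∞ := ENNReal.ofReal (Dn n) * Kn n * (ENNReal.ofReal (Dn n * M) + Q) * Pn n ^ (1/2 : ℝ)
    with hK
  have hKfin : K ≠ ⊤ := by
    refine ENNReal.mul_ne_top (ENNReal.mul_ne_top (ENNReal.mul_ne_top ENNReal.ofReal_ne_top
      (Kn_ne_top n)) (ENNReal.add_ne_top.2 ⟨ENNReal.ofReal_ne_top, hQfin⟩)) ?_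
    exact (ENNReal.rpow_lt_top_of_nonneg (by norm_num) (by simp [Pn])).ne
  refine ⟨K.toReal, fun f => ?_⟩
  rw [ENNReal.ofReal_toReal hKfin]
  have hmain := main_bound hcont.measurable M hM0 hM (fun j => (Ω j).toReal)
    (fun _ => ENNReal.toReal_nonneg) hw hlim (ftI n f) (ftI_cont n f).measurable (ftI_int n f)
    (ftI_memLp n f)
  rw [ftI_eLp, ← mul_assoc] at hmain
  exact hmain
end
end

section
/- For every s with 0 < s < n there exists a bounded continuous function σ on ℝⁿ × ℝⁿ ≅ ℝ^{2n} belonging to B^{s,∞}_∞(ℝ^{2n}), i.e. satisfying sup_{h∈ℝ^{2n}, h≠0} |h|^{−s} ‖Δ_h^{n+1} σ‖_∞ < ∞, such that σ(x,D) is not bounded from L²(ℝⁿ) to L²(ℝⁿ): there is no constant C with ‖σ(x,D)f‖_{L²(ℝⁿ)} ≤ C ‖f‖_{L²(ℝⁿ)} for all Schwartz functions f on ℝⁿ. -/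
open MeasureTheory Complex
open scoped RealInnerProductSpace ENNReal NNReal

noncomputable section

lemma idiff_bound (m : ℕ) : ∀ (G : ℂ → ℂ) (ρ M : ℝ), 0 < ρ → Differentiable ℂ G →
    (∀ z : ℂ, |z.im| ≤ m * ρ → ‖G z‖ ≤ M) →
    ∀ z : ℂ, z.im = 0 → ‖(idiff (1:ℂ))^[m] G z‖ ≤ M / ρ ^ m := by
  induction m with
  | zero =>
    intro G ρ M hρ hG hb z hz
    simpa using hb z (by simp [hz])
  | succ m ih =>
    intro G ρ M hρ hG hb z hz
    rw [Function.iterate_succ_apply]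
    have := ih (idiff 1 G) ρ (M / ρ) hρ ?_ ?_ z hz
    · rwa [div_div, ← pow_succ'] at this
    · unfold idiff
      fun_prop
    · intro z hz
      have hconv : Convex ℝ {w : ℂ | |w.im| ≤ m * ρ} := by
        have h := (convex_Icc (-(m * ρ)) (m * ρ)).linear_preimage Complex.imLm
        have e : {w : ℂ | |w.im| ≤ m * ρ} =
            Complex.imLm ⁻¹' Set.Icc (-(m * ρ)) (m * ρ) := by
          ext w
          exact abs_le (a := w.im) (b := m * ρ)
        rw [e]; exact h
      have := hconv.norm_image_sub_le_of_norm_deriv_le (f := G) (C := M / ρ)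
        (fun x _ => hG x) ?_ (x := z) (y := z + 1) hz (by simpa using hz)
      · simpa [idiff] using this
      · intro x hx
        refine Complex.norm_deriv_le_of_forall_mem_sphere_norm_le hρ hG.diffContOnCl ?_
        intro w hw
        apply hb
        have h1 : |w.im - x.im| ≤ ρ := by
          have := Complex.abs_im_le_norm (w - x)
          rw [mem_sphere_iff_norm.1 hw] at this
          simpa using this
        have hx' : |x.im| ≤ m * ρ := hx
        push_cast
        have := abs_sub_abs_le_abs_sub w.im x.im
        linarith

lemma idiff_line {V : Type*} [AddCommGroup V] [Module ℝ V] (h X : V) (m : ℕ) :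
    ∀ (g : V → ℂ) (G : ℂ → ℂ), (∀ t : ℝ, g (X + t • h) = G t) →
    ∀ t : ℝ, (idiff h)^[m] g (X + t • h) = (idiff (1:ℂ))^[m] G t := by
  induction m with
  | zero => intro g G hg t; simpa using hg t
  | succ m ih =>
    intro g G hg t
    rw [Function.iterate_succ_apply, Function.iterate_succ_apply]
    apply ih
    intro t
    have := hg (t + 1)
    simp only [idiff, hg t]
    rw [← Complex.ofReal_one, ← Complex.ofReal_add, ← this, add_smul, one_smul, add_assoc]

lemma idiff_trivial {V : Type*} [Add V] (h : V) (m : ℕ) :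
    ∀ (g : V → ℂ), (∀ X, ‖g X‖ ≤ 1) → ∀ X, ‖(idiff h)^[m] g X‖ ≤ 2 ^ m := by
  induction m with
  | zero => intro g hg X; simpa using hg X
  | succ m ih =>
    intro g hg X
    rw [Function.iterate_succ_apply']
    have h1 := ih g hg X
    have h2 := ih g hg (X + h)
    have := norm_sub_le ((idiff h)^[m] g (X + h)) ((idiff h)^[m] g X)
    simp only [idiff] at *
    rw [pow_succ]; linarith

lemma idiff_hasSum {V : Type*} [Add V] (h : V) (m : ℕ) (F : ℕ → V → ℂ) (c : ℕ → ℂ) (σ : V → ℂ)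
    (hF : ∀ X, HasSum (fun k => c k * F k X) (σ X)) :
    ∀ X, HasSum (fun k => c k * (idiff h)^[m] (F k) X) ((idiff h)^[m] σ X) := by
  induction m with
  | zero => simpa using hF
  | succ m ih =>
    intro X
    simp only [Function.iterate_succ_apply']
    have := (ih (X + h)).sub (ih X)
    simpa [idiff, mul_sub] using this

/-- The single scale symbol. -/
def Esym (n : ℕ) (a : ℝ) (X : En n × En n) : ℂ :=
  Complex.exp (-(Complex.I * ((⟪X.1, X.2⟫ : ℝ) : ℂ))) *
    ((Real.exp (-((‖X.1‖ ^ 2 + ‖X.2‖ ^ 2) / a ^ 2)) : ℝ) : ℂ)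

lemma Esym_le (n : ℕ) (a : ℝ) (X : En n × En n) : ‖Esym n a X‖ ≤ 1 := by
  unfold Esym
  rw [norm_mul, Complex.norm_exp, Complex.norm_real]
  simp
  positivity

lemma Esym_diff (n N : ℕ) (a : ℝ) (ha : 1 ≤ a) (h X : En n × En n) (hh : 0 < pnorm2 n h) :
    ‖(idiff h)^[N] (Esym n a) X‖ ≤ Real.exp (2 * N ^ 2) * (a * pnorm2 n h) ^ N := by
  obtain ⟨x, ξ⟩ := X
  obtain ⟨h1, h2⟩ := h
  set δ := pnorm2 n (h1, h2) with hδ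
  have hδ2 : δ ^ 2 = ‖h1‖ ^ 2 + ‖h2‖ ^ 2 := by
    rw [hδ, pnorm2, Real.sq_sqrt (by positivity)]
  set G : ℂ → ℂ := fun z => Complex.exp (-(Complex.I * ((⟪x, ξ⟫ : ℝ) +
      (⟪x, h2⟫ + ⟪h1, ξ⟫ : ℝ) * z + (⟪h1, h2⟫ : ℝ) * z ^ 2)) -
      ((‖x‖ ^ 2 + ‖ξ‖ ^ 2 : ℝ) + (2 * (⟪x, h1⟫ + ⟪ξ, h2⟫) : ℝ) * z +
        (‖h1‖ ^ 2 + ‖h2‖ ^ 2 : ℝ) * z ^ 2) / ((a ^ 2 : ℝ) : ℂ)) with hG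
  have key : ∀ t : ℝ, Esym n a ((x, ξ) + t • (h1, h2)) = G t := by
    intro t
    simp only [Esym, hG, Prod.fst_add, Prod.snd_add, Prod.smul_fst, Prod.smul_snd]
    rw [Complex.ofReal_exp, ← Complex.exp_add]
    congr 1
    rw [norm_add_sq_real, norm_add_sq_real]
    simp only [inner_add_left, inner_add_right, real_inner_smul_left, real_inner_smul_right,
      norm_smul, mul_pow, Real.norm_eq_abs, sq_abs]
    push_cast
    ring
  have hl := idiff_line (h1, h2) (x, ξ) N (Esym n a) G key 0
  rw [zero_smul, add_zero] at hl
  rw [hl]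
  have ha0 : 0 < a := by linarith
  have hρ : 0 < 1 / (a * δ) := by positivity
  have := idiff_bound N G (1 / (a * δ)) (Real.exp (2 * N ^ 2)) hρ ?_ ?_ (0:ℝ) (by simp)
  · refine this.trans (le_of_eq ?_)
    rw [one_div, inv_pow, div_inv_eq_mul]
  · rw [hG]; fun_prop
  · intro z hz
    rw [hG]
    simp only [Complex.norm_exp]
    rw [Real.exp_le_exp]
    set t := z.re with ht
    set y := z.im with hy
    have e1 : (-(Complex.I * (((⟪x, ξ⟫ : ℝ) : ℂ) +
      (⟪x, h2⟫ + ⟪h1, ξ⟫ : ℝ) * z + (⟪h1, h2⟫ : ℝ) * z ^ 2)) -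
      ((‖x‖ ^ 2 + ‖ξ‖ ^ 2 : ℝ) + (2 * (⟪x, h1⟫ + ⟪ξ, h2⟫) : ℝ) * z +
        (‖h1‖ ^ 2 + ‖h2‖ ^ 2 : ℝ) * z ^ 2) / ((a ^ 2 : ℝ) : ℂ)).re =
        y * (⟪x + t • h1, h2⟫ + ⟪h1, ξ + t • h2⟫)
        - (‖x + t • h1‖ ^ 2 + ‖ξ + t • h2‖ ^ 2) / a ^ 2 + y ^ 2 * δ ^ 2 / a ^ 2 := by
      rw [norm_add_sq_real, norm_add_sq_real, hδ2]
      simp only [inner_add_left, inner_add_right, real_inner_smul_left, real_inner_smul_right,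
        norm_smul, mul_pow, Real.norm_eq_abs, sq_abs]
      simp only [Complex.sub_re, Complex.neg_re, Complex.div_ofReal_re,
        Complex.add_im, Complex.add_re, Complex.ofReal_im, Complex.ofReal_re,
        pow_two, Complex.mul_re, Complex.mul_im,
        ← ht, ← hy, Complex.I_re, Complex.I_im]
      ring
    rw [e1]
    set p := x + t • h1
    set q := ξ + t • h2
    have i1 : y * ⟪p, h2⟫ ≤ ‖p‖ ^ 2 / a ^ 2 + a ^ 2 * y ^ 2 * ‖h2‖ ^ 2 / 4 := by
      have c1 : y * ⟪p, h2⟫ ≤ |y| * (‖p‖ * ‖h2‖) := by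
        refine (le_abs_self _).trans ?_
        rw [abs_mul]
        exact mul_le_mul_of_nonneg_left (abs_real_inner_le_norm _ _) (abs_nonneg _)
      have c2 := sq_nonneg (‖p‖ / a - a * |y| * ‖h2‖ / 2)
      have c3 : (‖p‖ / a - a * |y| * ‖h2‖ / 2) ^ 2 =
        ‖p‖ ^ 2 / a ^ 2 + a ^ 2 * |y| ^ 2 * ‖h2‖ ^ 2 / 4 - |y| * (‖p‖ * ‖h2‖) := by
        field_simp
        ring
      rw [sq_abs] at c3
      linarith
    have i2 : y * ⟪h1, q⟫ ≤ ‖q‖ ^ 2 / a ^ 2 + a ^ 2 * y ^ 2 * ‖h1‖ ^ 2 / 4 := by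
      have c1 : y * ⟪h1, q⟫ ≤ |y| * (‖h1‖ * ‖q‖) := by
        refine (le_abs_self _).trans ?_
        rw [abs_mul]
        exact mul_le_mul_of_nonneg_left (abs_real_inner_le_norm _ _) (abs_nonneg _)
      have c2 := sq_nonneg (‖q‖ / a - a * |y| * ‖h1‖ / 2)
      have c3 : (‖q‖ / a - a * |y| * ‖h1‖ / 2) ^ 2 =
        ‖q‖ ^ 2 / a ^ 2 + a ^ 2 * |y| ^ 2 * ‖h1‖ ^ 2 / 4 - |y| * (‖h1‖ * ‖q‖) := by
        field_simp
        ring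
      rw [sq_abs] at c3
      linarith
    have i3 : a ^ 2 * y ^ 2 * δ ^ 2 ≤ N ^ 2 := by
      have : |y| * (a * δ) ≤ N := by
        rw [mul_one_div, le_div_iff₀ (by positivity)] at hz
        exact hz
      have h2 := pow_le_pow_left₀ (by positivity) this 2
      rw [mul_pow, mul_pow, sq_abs] at h2
      linarith
    have i4 : y ^ 2 * δ ^ 2 / a ^ 2 ≤ a ^ 2 * y ^ 2 * δ ^ 2 := by
      rw [div_le_iff₀ (by positivity)]
      have : 1 ≤ a ^ 2 * a ^ 2 := by
        have := one_le_pow₀ ha (n := 2); nlinarith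
      have h0 : 0 ≤ y ^ 2 * δ ^ 2 := by positivity
      nlinarith
    have i5 : a ^ 2 * y ^ 2 * ‖h2‖ ^ 2 / 4 + a ^ 2 * y ^ 2 * ‖h1‖ ^ 2 / 4
        = a ^ 2 * y ^ 2 * δ ^ 2 / 4 := by rw [hδ2]; ring
    have i6 : (0:ℝ) ≤ N ^ 2 := by positivity
    rw [add_div]
    linarith

lemma sum_bound (s : ℝ) (N : ℕ) (hs : 0 < s) (hN : s < N) : ∃ S : ℝ, ∀ δ : ℝ, 0 < δ →
    ∀ b : ℕ → ℝ, (∀ k, 0 ≤ b k) → (∀ k, b k ≤ 1) → (∀ k, b k ≤ (2 ^ k * δ) ^ N) →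
    Summable (fun k => ((2:ℝ) ^ (-s)) ^ k * b k) ∧
    ∑' k, ((2:ℝ) ^ (-s)) ^ k * b k ≤ S * δ ^ s := by
  set c := min s (N - s) with hc
  have hc0 : 0 < c := lt_min hs (by linarith)
  set θ : ℝ := (2:ℝ) ^ (-c) with hθ
  have hθ0 : 0 < θ := by positivity
  have hθ1 : θ < 1 := Real.rpow_lt_one_of_one_lt_of_neg (by norm_num) (by linarith)
  have hsum : Summable (fun j : ℤ => θ ^ j.natAbs) := by
    rw [summable_int_iff_summable_nat_and_neg]
    simpa using summable_geometric_of_lt_one hθ0.le hθ1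
  refine ⟨2 ^ (N - s) * ∑' j : ℤ, θ ^ j.natAbs, ?_⟩
  intro δ hδ b hb0 hb1 hbN
  obtain ⟨K, hK1, hK2⟩ := exists_mem_Ico_zpow hδ (one_lt_two (α := ℝ))
  have hinj : Function.Injective (fun k : ℕ => (k : ℤ) + K) := by
    intro a b hab; simpa using hab
  have hsum' : Summable (fun k : ℕ => θ ^ ((k : ℤ) + K).natAbs) := hsum.comp_injective hinj
  have hle : ∑' k : ℕ, θ ^ ((k : ℤ) + K).natAbs ≤ ∑' j : ℤ, θ ^ j.natAbs :=
    _root_.tsum_comp_le_tsum_of_inj hsum (fun j => by positivity) hinj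
  have h2 : (1:ℝ) ≤ 2 ^ (N - s) := Real.one_le_rpow (by norm_num) (by linarith)
  have term : ∀ k : ℕ, ((2:ℝ) ^ (-s)) ^ k * b k ≤
      δ ^ s * 2 ^ (N - s) * θ ^ ((k : ℤ) + K).natAbs := by
    intro k
    set u : ℝ := 2 ^ k * δ with hu
    have hu0 : 0 < u := by positivity
    have e1 : ((2:ℝ) ^ (-s)) ^ k = δ ^ s * u ^ (-s) := by
      rw [hu, Real.mul_rpow (by positivity) hδ.le, Real.rpow_neg hδ.le,
        ← Real.rpow_natCast, ← Real.rpow_natCast, ← Real.rpow_mul (by norm_num),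
        ← Real.rpow_mul (by norm_num)]
      field_simp
    have hθj : θ ^ ((k : ℤ) + K).natAbs = (2:ℝ) ^ (-(c * |((k:ℝ) + K)|)) := by
      rw [hθ, ← Real.rpow_natCast, ← Real.rpow_mul (by norm_num)]
      congr 1
      rw [Nat.cast_natAbs]
      push_cast
      ring
    have hu1 : (2:ℝ) ^ ((k:ℝ) + K) ≤ u := by
      rw [Real.rpow_add (by norm_num), Real.rpow_natCast, Real.rpow_intCast]
      exact mul_le_mul_of_nonneg_left hK1 (by positivity)
    have hu2 : u ≤ (2:ℝ) ^ ((k:ℝ) + K + 1) := by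
      rw [add_assoc, Real.rpow_add (by norm_num), Real.rpow_natCast]
      refine mul_le_mul_of_nonneg_left (hK2.le.trans (le_of_eq ?_)) (by positivity)
      rw [← Real.rpow_intCast]; push_cast; rfl
    rw [e1, mul_assoc, mul_assoc]
    refine mul_le_mul_of_nonneg_left ?_ (by positivity)
    rw [hθj]
    rcases le_total 0 ((k:ℝ) + K) with hj | hj
    · calc u ^ (-s) * b k ≤ u ^ (-s) * 1 :=
            mul_le_mul_of_nonneg_left (hb1 k) (by positivity)
        _ ≤ ((2:ℝ) ^ ((k:ℝ) + K)) ^ (-s) := by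
            rw [mul_one]
            exact Real.rpow_le_rpow_of_nonpos (by positivity) hu1 (by linarith)
        _ = 2 ^ (-(s * ((k:ℝ) + K))) := by
            rw [← Real.rpow_mul (by norm_num)]; congr 1; ring
        _ ≤ 2 ^ (-(c * |(k:ℝ) + K|)) := by
            apply Real.rpow_le_rpow_of_exponent_le (by norm_num)
            rw [abs_of_nonneg hj]
            have := mul_le_mul_of_nonneg_right (min_le_left s (N - s)) hj
            linarith
        _ ≤ _ := le_mul_of_one_le_left (by positivity) h2
    · calc u ^ (-s) * b k ≤ u ^ (-s) * u ^ N :=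
            mul_le_mul_of_nonneg_left (hbN k) (by positivity)
        _ = u ^ (N - s) := by
            rw [← Real.rpow_natCast, ← Real.rpow_add hu0]; congr 1; ring
        _ ≤ ((2:ℝ) ^ ((k:ℝ) + K + 1)) ^ (N - s) :=
            Real.rpow_le_rpow hu0.le hu2 (by linarith)
        _ = 2 ^ (N - s) * 2 ^ ((N - s) * ((k:ℝ) + K)) := by
            rw [← Real.rpow_mul (by norm_num), ← Real.rpow_add (by norm_num)]; congr 1; ring
        _ ≤ _ := by
            refine mul_le_mul_of_nonneg_left ?_ (by positivity)
            apply Real.rpow_le_rpow_of_exponent_le (by norm_num)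
            rw [abs_of_nonpos hj]
            have := mul_le_mul_of_nonneg_right (min_le_right s (N - s)) (neg_nonneg.2 hj)
            linarith
  have hS2 : Summable (fun k : ℕ => δ ^ s * 2 ^ (N - s) * θ ^ ((k : ℤ) + K).natAbs) :=
    hsum'.mul_left _
  have hS1 : Summable (fun k => ((2:ℝ) ^ (-s)) ^ k * b k) :=
    Summable.of_nonneg_of_le (fun k => mul_nonneg (by positivity) (hb0 k)) term hS2
  refine ⟨hS1, (hS1.tsum_le_tsum term hS2).trans ?_⟩
  rw [tsum_mul_left]
  have : δ ^ s * 2 ^ (N - s) * ∑' k : ℕ, θ ^ ((k : ℤ) + K).natAbs ≤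
      δ ^ s * 2 ^ (N - s) * ∑' j : ℤ, θ ^ j.natAbs :=
    mul_le_mul_of_nonneg_left hle (by positivity)
  linarith

/-- The weight. -/
def wgt (n : ℕ) (s : ℝ) (X : En n × En n) : ℝ :=
  ∑' k : ℕ, ((2:ℝ) ^ (-s)) ^ k * Real.exp (-((‖X.1‖ ^ 2 + ‖X.2‖ ^ 2) / (2 ^ k) ^ 2))

lemma wgt_term_le (n : ℕ) (s : ℝ) (X : En n × En n) (k : ℕ) :
    ((2:ℝ) ^ (-s)) ^ k * Real.exp (-((‖X.1‖ ^ 2 + ‖X.2‖ ^ 2) / (2 ^ k) ^ 2)) ≤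
      ((2:ℝ) ^ (-s)) ^ k := by
  apply mul_le_of_le_one_right (by positivity)
  rw [Real.exp_le_one_iff]
  have : 0 ≤ (‖X.1‖ ^ 2 + ‖X.2‖ ^ 2) / ((2:ℝ) ^ k) ^ 2 := by positivity
  linarith

lemma geo_summable (s : ℝ) (hs : 0 < s) : Summable (fun k : ℕ => ((2:ℝ) ^ (-s)) ^ k) :=
  summable_geometric_of_lt_one (by positivity)
    (Real.rpow_lt_one_of_one_lt_of_neg (by norm_num) (by linarith))

lemma wgt_summable (n : ℕ) (s : ℝ) (hs : 0 < s) (X : En n × En n) :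
    Summable (fun k : ℕ => ((2:ℝ) ^ (-s)) ^ k *
      Real.exp (-((‖X.1‖ ^ 2 + ‖X.2‖ ^ 2) / (2 ^ k) ^ 2))) :=
  Summable.of_nonneg_of_le (fun k => by positivity) (wgt_term_le n s X) (geo_summable s hs)

lemma wgt_nonneg (n : ℕ) (s : ℝ) (X : En n × En n) : 0 ≤ wgt n s X :=
  tsum_nonneg (fun k => by positivity)

lemma wgt_le (n : ℕ) (s : ℝ) (hs : 0 < s) (X : En n × En n) :
    wgt n s X ≤ ∑' k : ℕ, ((2:ℝ) ^ (-s)) ^ k :=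
  (wgt_summable n s hs X).tsum_le_tsum (wgt_term_le n s X) (geo_summable s hs)

lemma wgt_cont (n : ℕ) (s : ℝ) (hs : 0 < s) : Continuous (wgt n s) := by
  unfold wgt
  refine continuous_tsum (u := fun k : ℕ => ((2:ℝ) ^ (-s)) ^ k) ?_ (geo_summable s hs) ?_
  · intro k; fun_prop
  · intro k X
    rw [Real.norm_of_nonneg (by positivity)]
    exact wgt_term_le n s X k

lemma wgt_lower (n : ℕ) (s : ℝ) (hs : 0 < s) (k : ℕ) (x ξ : En n) (hx : ‖x‖ ≤ 2 ^ k)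
    (hξ : ‖ξ‖ ≤ 2 ^ k) : Real.exp (-2) * ((2:ℝ) ^ (-s)) ^ k ≤ wgt n s (x, ξ) := by
  refine le_trans ?_ ((wgt_summable n s hs (x, ξ)).le_tsum k (fun j _ => by positivity))
  rw [mul_comm]
  refine mul_le_mul_of_nonneg_left ?_ (by positivity)
  rw [Real.exp_le_exp, neg_le_neg_iff, div_le_iff₀ (by positivity)]
  have h1 := pow_le_pow_left₀ (norm_nonneg x) hx 2
  have h2 := pow_le_pow_left₀ (norm_nonneg ξ) hξ 2
  simp only
  linarith

/-- The symbol. -/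
def sym (n : ℕ) (s : ℝ) (X : En n × En n) : ℂ :=
  Complex.exp (-(Complex.I * ((⟪X.1, X.2⟫ : ℝ) : ℂ))) * ((wgt n s X : ℝ) : ℂ)

lemma sym_norm (n : ℕ) (s : ℝ) (X : En n × En n) : ‖sym n s X‖ = wgt n s X := by
  unfold sym
  rw [norm_mul, Complex.norm_exp, Complex.norm_real, Real.norm_of_nonneg (wgt_nonneg n s X)]
  simp

lemma sym_hasSum (n : ℕ) (s : ℝ) (hs : 0 < s) (X : En n × En n) :
    HasSum (fun k : ℕ => ((((2:ℝ) ^ (-s)) ^ k : ℝ) : ℂ) * Esym n (2 ^ k) X) (sym n s X) := by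
  have h := (wgt_summable n s hs X).hasSum
  have h2 := (Complex.hasSum_ofReal.2 h).mul_left
    (Complex.exp (-(Complex.I * ((⟪X.1, X.2⟫ : ℝ) : ℂ))))
  have e : (fun k : ℕ => ((((2:ℝ) ^ (-s)) ^ k : ℝ) : ℂ) * Esym n (2 ^ k) X) =
      fun k : ℕ => Complex.exp (-(Complex.I * ((⟪X.1, X.2⟫ : ℝ) : ℂ))) *
      ((((2:ℝ) ^ (-s)) ^ k *
        Real.exp (-((‖X.1‖ ^ 2 + ‖X.2‖ ^ 2) / (2 ^ k) ^ 2)) : ℝ) : ℂ) := by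
    funext k
    rw [Esym, Complex.ofReal_mul]
    ring
  rw [e]
  exact h2

lemma sym_holder (n N : ℕ) (s : ℝ) (hs : 0 < s) (hN : s < N) :
    ∃ B : ℝ, ∀ h : En n × En n, h ≠ 0 → ∀ X : En n × En n,
        ‖(idiff h)^[N] (sym n s) X‖ ≤ B * pnorm2 n h ^ s := by
  obtain ⟨S, hS⟩ := sum_bound s N hs hN
  set D : ℝ := Real.exp (2 * N ^ 2) + 2 ^ N with hD
  have hD0 : 0 < D := by positivity
  refine ⟨D * S, fun h hh X => ?_⟩
  have hp : 0 < pnorm2 n h := by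
    unfold pnorm2
    apply Real.sqrt_pos.2
    by_contra hc
    apply hh
    have a1 := sq_nonneg ‖h.1‖
    have a2 := sq_nonneg ‖h.2‖
    have b1 : ‖h.1‖ ^ 2 = 0 := by linarith
    have b2 : ‖h.2‖ ^ 2 = 0 := by linarith
    exact Prod.ext (norm_eq_zero.1 (pow_eq_zero_iff two_ne_zero |>.1 b1))
      (norm_eq_zero.1 (pow_eq_zero_iff two_ne_zero |>.1 b2))
  have hs1 := idiff_hasSum h N (fun k => Esym n (2 ^ k))
    (fun k : ℕ => ((((2:ℝ) ^ (-s)) ^ k : ℝ) : ℂ)) (sym n s) (sym_hasSum n s hs) X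
  obtain ⟨hb1, hb2⟩ := hS (pnorm2 n h) hp
    (fun k => ‖(idiff h)^[N] (Esym n (2 ^ k)) X‖ / D) (fun k => by positivity)
    (fun k => by
      rw [div_le_one hD0]
      have := idiff_trivial h N (Esym n (2 ^ k)) (Esym_le n _) X
      have h0 := Real.exp_pos (2 * N ^ 2)
      linarith)
    (fun k => by
      rw [div_le_iff₀ hD0]
      refine (Esym_diff n N (2 ^ k) (one_le_pow₀ (by norm_num)) h X hp).trans ?_
      rw [mul_comm]
      refine mul_le_mul_of_nonneg_left ?_ (by positivity)
      rw [hD]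
      have : (0:ℝ) < 2 ^ N := by positivity
      linarith)
  have hnorm : ∀ k : ℕ, ‖((((2:ℝ) ^ (-s)) ^ k : ℝ) : ℂ) * (idiff h)^[N] (Esym n (2 ^ k)) X‖ =
      D * (((2:ℝ) ^ (-s)) ^ k * (‖(idiff h)^[N] (Esym n (2 ^ k)) X‖ / D)) := by
    intro k
    rw [norm_mul, Complex.norm_real, Real.norm_of_nonneg (by positivity)]
    field_simp
  rw [← hs1.tsum_eq]
  have hsn : Summable (fun k : ℕ =>
      ‖((((2:ℝ) ^ (-s)) ^ k : ℝ) : ℂ) * (idiff h)^[N] (Esym n (2 ^ k)) X‖) := by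
    simp_rw [hnorm]
    exact hb1.mul_left D
  refine (norm_tsum_le_tsum_norm hsn).trans ?_
  simp_rw [hnorm]
  rw [tsum_mul_left, mul_assoc]
  exact mul_le_mul_of_nonneg_left hb2 hD0.le

open scoped FourierTransform SchwartzMap ContDiff in
lemma test_fun (n : ℕ) (R : ℝ) (hR : 0 < R) : ∃ (f : SchwartzMap (En n) ℂ) (ψ : En n → ℝ),
    Continuous ψ ∧ HasCompactSupport ψ ∧ (∀ ξ, 0 ≤ ψ ξ) ∧ (∀ ξ, ‖ξ‖ ≤ R → ψ ξ = 1) ∧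
    (∀ ξ, ftI n f ξ = (ψ ξ : ℂ)) ∧
    eLpNorm (⇑f) 2 volume ≤ volume (Metric.closedBall (0 : En n) (2 * R)) ^ (1 / 2 : ℝ) := by
  let b : ContDiffBump (0 : En n) := ⟨R, 2 * R, hR, by linarith⟩
  have hbs : HasCompactSupport (fun x => ((b x : ℝ) : ℂ)) :=
    b.hasCompactSupport.comp_left (g := fun r : ℝ => (r : ℂ)) (by simp)
  let φ : SchwartzMap (En n) ℂ := hbs.toSchwartzMap
    (Complex.ofRealCLM.contDiff.comp b.contDiff)
  have hφ : ∀ x, φ x = ((b x : ℝ) : ℂ) := fun x => rfl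
  have hpi : (0:ℝ) < 2 * Real.pi := by positivity
  refine ⟨𝓕⁻ φ, fun ξ => b ((2 * Real.pi)⁻¹ • ξ), ?_, ?_, ?_, ?_, ?_, ?_⟩
  · exact b.continuous.comp (continuous_const_smul _)
  · exact b.hasCompactSupport.comp_homeomorph (Homeomorph.smulOfNeZero _ (inv_ne_zero hpi.ne'))
  · intro ξ; exact b.nonneg
  · intro ξ hξ
    apply b.one_of_mem_closedBall
    rw [mem_closedBall_zero_iff, norm_smul, Real.norm_of_nonneg (by positivity)]
    have : (2 * Real.pi)⁻¹ ≤ 1 := by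
      apply inv_le_one_of_one_le₀
      have := Real.pi_gt_three
      linarith
    calc (2 * Real.pi)⁻¹ * ‖ξ‖ ≤ 1 * ‖ξ‖ := by gcongr
      _ ≤ R := by linarith
  · intro ξ
    have h1 : 𝓕 (𝓕⁻ φ) = φ := FourierTransform.fourier_fourierInv_eq φ
    have h2 := congrArg (fun g : SchwartzMap (En n) ℂ => g ((2 * Real.pi)⁻¹ • ξ)) h1
    simp only [SchwartzMap.fourier_coe] at h2
    rw [← hφ, ← h2, Real.fourier_eq']
    unfold ftI
    congr 1
    ext x
    rw [smul_eq_mul]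
    congr 2
    rw [real_inner_smul_right]
    have : -2 * Real.pi * ((2 * Real.pi)⁻¹ * ⟪x, ξ⟫) = -⟪x, ξ⟫ := by
      field_simp
    rw [this]
    push_cast
    ring
  · have h1 : ‖(𝓕⁻ φ).toLp 2‖ = ‖φ.toLp 2‖ := by
      have := SchwartzMap.norm_fourier_toL2_eq (𝓕⁻ φ)
      rw [FourierTransform.fourier_fourierInv_eq φ] at this
      exact this.symm
    rw [SchwartzMap.norm_toLp, SchwartzMap.norm_toLp] at h1
    rw [ENNReal.toReal_eq_toReal_iff' ((𝓕⁻ φ).memLp 2 volume).2.ne (φ.memLp 2 volume).2.ne] at h1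
    rw [h1]
    have h2 : eLpNorm (⇑φ) 2 volume ≤
        eLpNorm ((Metric.closedBall (0 : En n) (2 * R)).indicator fun _ => (1:ℝ)) 2 volume := by
      apply eLpNorm_mono
      intro x
      rw [hφ, Complex.norm_real]
      by_cases hx : x ∈ Metric.closedBall (0 : En n) (2 * R)
      · rw [Set.indicator_of_mem hx, Real.norm_of_nonneg b.nonneg]
        simpa using b.le_one
      · have : b x = 0 := b.zero_of_le_dist (by
          rw [Metric.mem_closedBall, not_le] at hx
          exact hx.le)
        rw [this]; simp
    refine h2.trans ((eLpNorm_indicator_const_le _ _).trans (le_of_eq ?_))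
    simp

lemma op_lower (n : ℕ) (s : ℝ) (hs : 0 < s) (k : ℕ) (f : SchwartzMap (En n) ℂ) (ψ : En n → ℝ)
    (hc : Continuous ψ) (hcs : HasCompactSupport ψ) (h0 : ∀ ξ, 0 ≤ ψ ξ)
    (h1 : ∀ ξ, ‖ξ‖ ≤ 2 ^ k → ψ ξ = 1) (hf : ∀ ξ, ftI n f ξ = (ψ ξ : ℂ)) (x : En n)
    (hx : ‖x‖ ≤ 2 ^ k) :
    Real.exp (-2) * ((2:ℝ) ^ (-s)) ^ k * (volume (Metric.closedBall (0 : En n) (2 ^ k))).toReal ≤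
    ‖∫ ξ : En n,
        Complex.exp (Complex.I * ((⟪x, ξ⟫ : ℝ) : ℂ)) * sym n s (x, ξ) * ftI n (⇑f) ξ‖ := by
  have e : ∀ ξ : En n, Complex.exp (Complex.I * ((⟪x, ξ⟫ : ℝ) : ℂ)) * sym n s (x, ξ) * ftI n (⇑f) ξ
      = ((wgt n s (x, ξ) * ψ ξ : ℝ) : ℂ) := by
    intro ξ
    rw [hf, sym, ← mul_assoc, ← Complex.exp_add]
    simp
  simp_rw [e]
  rw [integral_complex_ofReal, Complex.norm_real]
  refine le_trans ?_ (Real.le_norm_self _)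
  have hint : Integrable (fun ξ => wgt n s (x, ξ) * ψ ξ) := by
    apply Continuous.integrable_of_hasCompactSupport
    · exact ((wgt_cont n s hs).comp (by fun_prop)).mul hc
    · exact hcs.mul_left
  calc _ = ∫ ξ, (Metric.closedBall (0 : En n) (2 ^ k)).indicator
        (fun _ => Real.exp (-2) * ((2:ℝ) ^ (-s)) ^ k) ξ := by
        rw [integral_indicator_const _ Metric.isClosed_closedBall.measurableSet, smul_eq_mul,
          mul_comm]
        rfl
    _ ≤ _ := by
        apply integral_mono _ hint
        · intro ξ
          by_cases hξ : ξ ∈ Metric.closedBall (0 : En n) (2 ^ k)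
          · rw [Set.indicator_of_mem hξ]
            rw [mem_closedBall_zero_iff] at hξ
            simp only [h1 ξ hξ, mul_one]
            exact wgt_lower n s hs k x ξ hx hξ
          · rw [Set.indicator_of_notMem hξ]
            exact mul_nonneg (wgt_nonneg _ _ _) (h0 ξ)
        · exact (integrable_indicator_iff Metric.isClosed_closedBall.measurableSet).2
            (integrableOn_const (by exact measure_closedBall_lt_top.ne))

theorem stmt_7 (n : ℕ) (hn : 1 ≤ n) (s : ℝ) (hs0 : 0 < s) (hsn : s < n) :
    ∃ σ : En n × En n → ℂ,
      Continuous σ ∧ (∃ M : ℝ, ∀ X : En n × En n, ‖σ X‖ ≤ M) ∧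
      (∃ B : ℝ, ∀ h : En n × En n, h ≠ 0 → ∀ X : En n × En n,
        ‖(idiff h)^[n + 1] σ X‖ ≤ B * pnorm2 n h ^ s) ∧
      ¬∃ C : ℝ, ∀ f : SchwartzMap (En n) ℂ,
        eLpNorm (fun x : En n => ∫ ξ : En n,
            Complex.exp (Complex.I * ((⟪x, ξ⟫ : ℝ) : ℂ)) * σ (x, ξ) * ftI n (⇑f) ξ) 2 volume ≤
          ENNReal.ofReal C * eLpNorm (⇑f) 2 volume := by
  refine ⟨sym n s, ?_, ⟨_, fun X => (sym_norm n s X).le.trans (wgt_le n s hs0 X)⟩,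
    sym_holder n (n + 1) s hs0 (by push_cast; linarith), ?_⟩
  · have := wgt_cont n s hs0
    unfold sym
    fun_prop
  rintro ⟨C, hC⟩
  set v : ℝ := (volume (Metric.ball (0 : En n) 1)).toReal with hv
  have hv0 : 0 < v := ENNReal.toReal_pos (Metric.measure_ball_pos _ _ one_pos).ne'
    measure_ball_lt_top.ne
  set D : ℝ≥0∞ := ENNReal.ofReal C * ENNReal.ofReal (2 ^ n) ^ (1 / 2 : ℝ) with hD
  have hDt : D ≠ ⊤ := ENNReal.mul_ne_top ENNReal.ofReal_ne_top
    (ENNReal.rpow_ne_top_of_nonneg (by norm_num) ENNReal.ofReal_ne_top)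
  have main : ∀ k : ℕ, Real.exp (-2) * v * ((2:ℝ) ^ (n - s)) ^ k ≤ D.toReal := by
    intro k
    obtain ⟨f, ψ, a1, a2, a3, a4, a5, a6⟩ := test_fun n (2 ^ k) (by positivity)
    set V := volume (Metric.closedBall (0 : En n) (2 ^ k)) with hV
    have hV' : V = ENNReal.ofReal ((2 ^ k) ^ n) * volume (Metric.ball (0 : En n) 1) := by
      rw [hV, Measure.addHaar_closedBall _ _ (by positivity), finrank_euclideanSpace_fin]
    have hV0 : V ≠ 0 := (Metric.measure_closedBall_pos _ _ (by positivity)).ne'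
    have hVt : V ≠ ⊤ := measure_closedBall_lt_top.ne
    have hV2 : volume (Metric.closedBall (0 : En n) (2 * 2 ^ k)) = ENNReal.ofReal (2 ^ n) * V := by
      rw [Measure.addHaar_closedBall_mul _ _ (by norm_num) (by positivity),
        finrank_euclideanSpace_fin]
    set c : ℝ := Real.exp (-2) * ((2:ℝ) ^ (-s)) ^ k * V.toReal with hc
    have hc0 : 0 ≤ c := by positivity
    have hcv : c = Real.exp (-2) * v * ((2:ℝ) ^ (n - s)) ^ k := by
      rw [hc, hV', ENNReal.toReal_mul, ENNReal.toReal_ofReal (by positivity), ← hv,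
        sub_eq_add_neg, Real.rpow_add (by norm_num), Real.rpow_natCast, mul_pow, ← pow_mul,
        ← pow_mul, mul_comm k n]
      ring
    have low : ENNReal.ofReal c * V ^ (1 / 2 : ℝ) ≤ eLpNorm (fun x : En n => ∫ ξ : En n,
            Complex.exp (Complex.I * ((⟪x, ξ⟫ : ℝ) : ℂ)) * sym n s (x, ξ) * ftI n (⇑f) ξ)
            2 volume := by
      have h1 : eLpNorm ((Metric.closedBall (0 : En n) (2 ^ k)).indicator fun _ => c) 2 volume =
          ENNReal.ofReal c * V ^ (1 / 2 : ℝ) := by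
        rw [eLpNorm_indicator_const Metric.isClosed_closedBall.measurableSet (by norm_num)
          (by norm_num), Real.enorm_of_nonneg hc0]
        simp [hV]
      rw [← h1]
      apply eLpNorm_mono
      intro x
      by_cases hx : x ∈ Metric.closedBall (0 : En n) (2 ^ k)
      · rw [Set.indicator_of_mem hx, Real.norm_of_nonneg hc0]
        exact op_lower n s hs0 k f ψ a1 a2 a3 a4 a5 x (mem_closedBall_zero_iff.1 hx)
      · rw [Set.indicator_of_notMem hx]
        simp
    have hfin : ENNReal.ofReal c * V ^ (1 / 2 : ℝ) ≤ D * V ^ (1 / 2 : ℝ) := by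
      refine low.trans ((hC f).trans ?_)
      rw [hD, mul_assoc, ← ENNReal.mul_rpow_of_nonneg _ _ (by norm_num), ← hV2]
      gcongr
    have hle : ENNReal.ofReal c ≤ D :=
      (ENNReal.mul_le_mul_iff_left (by simp [hV0, hVt])
        (ENNReal.rpow_ne_top_of_nonneg (by norm_num) hVt)).1 hfin
    rw [← hcv]
    exact (ENNReal.ofReal_le_iff_le_toReal hDt).1 hle
  have hgt : (1:ℝ) < 2 ^ (n - s) := Real.one_lt_rpow (by norm_num) (by linarith)
  obtain ⟨k, hk⟩ := pow_unbounded_of_one_lt (D.toReal / (Real.exp (-2) * v)) hgt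
  rw [div_lt_iff₀ (by positivity)] at hk
  have := main k
  linarith
end
end

section
/- For every s with 0 < s < n there exists a measurable function σ on ℝⁿ × ℝⁿ ≅ ℝ^{2n} belonging to B^s, i.e. satisfying ∑_{j≥0} 2^{(n+s)j} ω(j) < ∞, such that for every p with 1 ≤ p ≤ ∞ the operator σ(x,D) is not bounded from L^p(ℝⁿ) to L^p(ℝⁿ): there is no constant C with ‖σ(x,D)f‖_{L^p(ℝⁿ)} ≤ C ‖f‖_{L^p(ℝⁿ)} for all Schwartz functions f on ℝⁿ. -/
open MeasureTheory Complex
open scoped RealInnerProductSpace ENNReal NNReal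

noncomputable section

/-- The unit coordinate vector `eᵢ` of `ℝⁿ`. -/
def unitE (n : ℕ) (i : Fin n) : En n := EuclideanSpace.single i 1

/-- The set `I_{2n}` of the `2n` standard unit coordinate vectors of `ℝⁿ × ℝⁿ ≅ ℝ^{2n}`. -/
def I2n (n : ℕ) : Set (En n × En n) :=
  (Set.range fun i => (unitE n i, (0 : En n))) ∪ (Set.range fun i => ((0 : En n), unitE n i))

/-- The dyadic cube `2^{−j}k + 2^{−j}Q`, where `Q = [0,1]ⁿ`. -/
def dyadicCube (n : ℕ) (j : ℕ) (k : Fin n → ℤ) : Set (En n) :=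
  {x | ∀ i, x i ∈ Set.Icc ((2 : ℝ) ^ (-(j : ℝ)) * k i) ((2 : ℝ) ^ (-(j : ℝ)) * (k i + 1))}

/-- `ω(0) = sup_k ∫_{k+Q} ∫_{ℝⁿ} |σ(x,ξ)| dξ dx` and, for `j ≥ 1`,
`ω(j) = sup_{k, e ∈ I_{2n}} ∫_{2^{−j}k+2^{−j}Q} ∫_{ℝⁿ} |σ_{j,e}(x,ξ)| dξ dx`,
with `σ_{j,e} = (τ_{2^{−j}e})ⁿ σ`. -/
def omegaSymb (n : ℕ) (σ : En n × En n → ℂ) : ℕ → ℝ≥0∞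
  | 0 => ⨆ k : Fin n → ℤ,
      ∫⁻ x in dyadicCube n 0 k, ∫⁻ ξ : En n, (‖σ (x, ξ)‖₊ : ℝ≥0∞)
  | (j + 1) => ⨆ (k : Fin n → ℤ) (e : En n × En n) (_ : e ∈ I2n n),
      ∫⁻ x in dyadicCube n (j + 1) k,
        ∫⁻ ξ : En n, (‖(idiff ((2 : ℝ) ^ (-((j : ℝ) + 1)) • e))^[n] σ (x, ξ)‖₊ : ℝ≥0∞)


open scoped Nat

lemma poly_mul_gauss_le {b : ℝ} (hb : 0 < b) (P : ℕ) (r : ℝ) (hr : 0 ≤ r) :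
    (1 + r) ^ P * Real.exp (-b * r ^ 2) ≤ P ! * (b ^ P)⁻¹ * Real.exp (2 * b) := by
  have h1 := Real.pow_div_factorial_le_exp (b * (1 + r)) (by positivity) P
  have h2 : (1 + r) ^ P ≤ P ! * (b ^ P)⁻¹ * Real.exp (b * (1 + r)) := by
    rw [div_le_iff₀ (by positivity), mul_pow] at h1
    have hbP : 0 < b ^ P := by positivity
    rw [mul_assoc, mul_comm, mul_assoc, inv_mul_eq_div, le_div_iff₀ hbP]
    linarith
  calc (1 + r) ^ P * Real.exp (-b * r ^ 2)
      ≤ (P ! * (b ^ P)⁻¹ * Real.exp (b * (1 + r))) * Real.exp (-b * r ^ 2) := by gcongr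
    _ = P ! * (b ^ P)⁻¹ * Real.exp (b * (1 + r) + -b * r ^ 2) := by rw [Real.exp_add]; ring
    _ ≤ _ := by
      gcongr
      nlinarith [sq_nonneg (r - 1), mul_nonneg hb.le (sq_nonneg (r - 1)), mul_nonneg hb.le (sq_nonneg r)]

/-- The Gaussian as a real Schwartz function. -/
def gaussR (n : ℕ) (b : ℝ) (hb : 0 < b) : SchwartzMap (En n) ℝ where
  toFun := (fun t : ℝ => Real.exp (-b * t)) ∘ (fun x : En n => ‖x‖ ^ 2)
  smooth' := by
    apply ContDiff.comp
    · fun_prop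
    · exact contDiff_norm_sq ℝ
  decay' := by
    intro k m
    obtain ⟨l, M, hM, h⟩ :=
      (Function.hasTemperateGrowth_norm_sq (H := En n)).norm_iteratedFDeriv_le_uniform m
    refine ⟨m ! * (1 + b) ^ m * (1 + M) ^ m * ((k + l * m) ! * (b ^ (k + l * m))⁻¹ * Real.exp (2 * b)), ?_⟩
    intro x
    have key := norm_iteratedFDeriv_comp_le (𝕜 := ℝ) (n := m) (N := m)
      (g := fun t : ℝ => Real.exp (-b * t)) (f := fun x : En n => ‖x‖ ^ 2)
      (by fun_prop) (contDiff_norm_sq ℝ) le_rfl x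
      (C := (1 + b) ^ m * Real.exp (-b * ‖x‖ ^ 2)) (D := (1 + M) * (1 + ‖x‖) ^ l) ?_ ?_
    · calc ‖x‖ ^ k * _ ≤ (1 + ‖x‖) ^ k * (m ! * ((1 + b) ^ m * Real.exp (-b * ‖x‖ ^ 2)) *
            ((1 + M) * (1 + ‖x‖) ^ l) ^ m) := by
            gcongr
            linarith [norm_nonneg (x : En n)]
        _ = m ! * (1 + b) ^ m * (1 + M) ^ m * ((1 + ‖x‖) ^ (k + l * m) * Real.exp (-b * ‖x‖ ^ 2)) := by
            rw [mul_pow, ← pow_mul, pow_add]; ring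
        _ ≤ _ := by
            exact mul_le_mul_of_nonneg_left (poly_mul_gauss_le hb _ ‖x‖ (norm_nonneg x)) (by positivity)
    · intro i hi
      rw [norm_iteratedFDeriv_eq_norm_iteratedDeriv, iteratedDeriv_exp_const_mul]
      rw [norm_mul, norm_pow, Real.norm_eq_abs, Real.norm_eq_abs, Real.abs_exp, abs_neg, abs_of_pos hb]
      gcongr
      calc b ^ i ≤ (1 + b) ^ i := by gcongr; linarith
        _ ≤ _ := pow_le_pow_right₀ (by linarith) hi
    · intro i hi1 hi
      have h1 : 1 ≤ (1 + M) * (1 + ‖x‖) ^ l := by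
        have : 1 ≤ (1 + ‖x‖) ^ l := one_le_pow₀ (by linarith [norm_nonneg (x : En n)])
        nlinarith [norm_nonneg (x : En n)]
      calc _ ≤ M * (1 + ‖x‖) ^ l := h i hi x
        _ ≤ (1 + M) * (1 + ‖x‖) ^ l := by gcongr; linarith
        _ ≤ _ := le_self_pow₀ h1 (by omega)

/-- The Gaussian as a complex Schwartz function. -/
def gaussC (n : ℕ) (b : ℝ) (hb : 0 < b) : SchwartzMap (En n) ℂ :=
  (gaussR n b hb).postcompCLM Complex.ofRealCLM

lemma gaussC_apply (n : ℕ) (b : ℝ) (hb : 0 < b) (x : En n) :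
    gaussC n b hb x = ((Real.exp (-b * ‖x‖ ^ 2) : ℝ) : ℂ) := rfl

/-- Fourier integral of a Gaussian. -/
lemma int_gauss_osc (n : ℕ) {b : ℝ} (hb : 0 < b) (c : ℂ) (hc : c ^ 2 = -1) (w : En n) :
    ∫ v : En n, Complex.exp (c * ((⟪w, v⟫ : ℝ) : ℂ)) * ((Real.exp (-b * ‖v‖ ^ 2) : ℝ) : ℂ)
      = (((Real.pi / b) ^ ((n : ℝ) / 2) * Real.exp (-(4 * b)⁻¹ * ‖w‖ ^ 2) : ℝ) : ℂ) := by
  have h := GaussianFourier.integral_cexp_neg_mul_sq_norm_add (V := En n) (b := (b : ℂ))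
    (by simpa using hb) c w
  have e1 : ∀ v : En n, Complex.exp (c * ((⟪w, v⟫ : ℝ) : ℂ)) * ((Real.exp (-b * ‖v‖ ^ 2) : ℝ) : ℂ)
      = Complex.exp (-(b : ℂ) * ‖v‖ ^ 2 + c * ((⟪w, v⟫ : ℝ) : ℂ)) := by
    intro v
    rw [Complex.exp_add, mul_comm]
    push_cast
    rfl
  simp_rw [e1]
  rw [h, hc]
  push_cast
  rw [Complex.ofReal_cpow (by positivity)]
  simp only [finrank_euclideanSpace, Fintype.card_fin]
  push_cast
  congr 2
  field_simp

lemma integrable_gauss (n : ℕ) {b : ℝ} (hb : 0 < b) :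
    Integrable (fun v : En n => Real.exp (-b * ‖v‖ ^ 2)) :=
  (gaussR n b hb).integrable

lemma ftI_gauss (n : ℕ) {b : ℝ} (hb : 0 < b) (ξ : En n) :
    ftI n (gaussC n b hb) ξ =
      (((Real.pi / b) ^ ((n : ℝ) / 2) * Real.exp (-(4 * b)⁻¹ * ‖ξ‖ ^ 2) : ℝ) : ℂ) := by
  rw [← int_gauss_osc n hb (-I) (by simp) ξ]
  unfold ftI
  congr 1
  ext x
  rw [gaussC_apply, real_inner_comm, neg_mul I]

/-- The real multiplier `∑ 2^{ak} exp(-4^k |ξ|²)`. -/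
def mulR (n : ℕ) (a : ℝ) (ξ : En n) : ℝ :=
  ∑' k : ℕ, (2 : ℝ) ^ (a * k) * Real.exp (-(4 : ℝ) ^ k * ‖ξ‖ ^ 2)

lemma mulR_measurable (n : ℕ) (a : ℝ) : Measurable (mulR n a) := by
  have : mulR n a = fun ξ => (∑' k : ℕ,
      ENNReal.ofReal ((2 : ℝ) ^ (a * k) * Real.exp (-(4 : ℝ) ^ k * ‖ξ‖ ^ 2))).toReal := by
    ext ξ
    rw [ENNReal.tsum_toReal_eq (fun _ => ENNReal.ofReal_ne_top)]
    unfold mulR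
    congr 1
    ext k
    rw [ENNReal.toReal_ofReal (by positivity)]
  rw [this]
  fun_prop

/-- The operator applied to a Gaussian dominates one term. -/
lemma op_gauss_lower (n : ℕ) (hn : 1 ≤ n) (a : ℝ) (han : a < n) (N : ℕ) (x : En n)
    (hb : 0 < (4 * (4 : ℝ) ^ N)⁻¹) :
    ((2 : ℝ) ^ (a * N) * Real.exp (-(4 * (4 : ℝ) ^ N)⁻¹ * ‖x‖ ^ 2)) ≤
    ‖∫ ξ : En n, Complex.exp (Complex.I * ((⟪x, ξ⟫ : ℝ) : ℂ)) * ((mulR n a ξ : ℝ) : ℂ) *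
      ftI n (gaussC n (4 * (4 : ℝ) ^ N)⁻¹ hb) ξ‖ := by
  set b := (4 * (4 : ℝ) ^ N)⁻¹ with hbdef
  have hb4 : (4 * b)⁻¹ = 4 ^ N := by rw [hbdef]; field_simp
  set A := (Real.pi / b) ^ ((n : ℝ) / 2) with hA
  have hApos : 0 < A := by positivity
  let F : ℕ → En n → ℂ := fun k ξ => Complex.exp (Complex.I * ((⟪x, ξ⟫ : ℝ) : ℂ)) *
    (((2 : ℝ) ^ (a * k) * Real.exp (-(4 : ℝ) ^ k * ‖ξ‖ ^ 2) : ℝ) : ℂ) *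
    ftI n (gaussC n b hb) ξ
  have hF : ∀ k ξ, F k ξ = (((2 : ℝ) ^ (a * k) * A : ℝ) : ℂ) *
      (Complex.exp (Complex.I * ((⟪x, ξ⟫ : ℝ) : ℂ)) *
        ((Real.exp (-(4 ^ k + 4 ^ N) * ‖ξ‖ ^ 2) : ℝ) : ℂ)) := by
    intro k ξ
    simp only [F]
    rw [ftI_gauss, hb4, neg_add, add_mul, Real.exp_add]
    push_cast
    ring
  have hint : ∀ k, ∫ ξ, F k ξ = (((2 : ℝ) ^ (a * k) * A * ((Real.pi / (4 ^ k + 4 ^ N)) ^ ((n : ℝ) / 2) *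
      Real.exp (-(4 * (4 ^ k + 4 ^ N))⁻¹ * ‖x‖ ^ 2)) : ℝ) : ℂ) := by
    intro k
    simp_rw [hF]
    rw [integral_const_mul, int_gauss_osc n (by positivity) I (by simp) x]
    push_cast
    rfl
  have hnorm : ∀ k ξ, ‖F k ξ‖ = (2 : ℝ) ^ (a * k) * A * Real.exp (-(4 ^ k + 4 ^ N) * ‖ξ‖ ^ 2) := by
    intro k ξ
    rw [hF, norm_mul, norm_mul, mul_comm Complex.I, Complex.norm_exp_ofReal_mul_I, one_mul, Complex.norm_real,
      Complex.norm_real, Real.norm_of_nonneg (by positivity), Real.norm_of_nonneg (by positivity)]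
  have hFint : ∀ k, Integrable (F k) := by
    intro k
    have hI : Integrable (fun ξ : En n => (2 : ℝ) ^ (a * k) * A * Real.exp (-(4 ^ k + 4 ^ N) * ‖ξ‖ ^ 2)) :=
      (integrable_gauss n (by positivity)).const_mul _
    refine hI.mono' ?_ (Filter.Eventually.of_forall fun ξ => (hnorm k ξ).le)
    have : F k = fun ξ => (((2 : ℝ) ^ (a * k) * A : ℝ) : ℂ) *
      (Complex.exp (Complex.I * ((⟪x, ξ⟫ : ℝ) : ℂ)) *
        ((Real.exp (-(4 ^ k + 4 ^ N) * ‖ξ‖ ^ 2) : ℝ) : ℂ)) := funext (hF k)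
    rw [this]
    apply Continuous.aestronglyMeasurable
    fun_prop
  have hnint : ∀ k, ∫ ξ, ‖F k ξ‖ = (2 : ℝ) ^ (a * k) * A * (Real.pi / (4 ^ k + 4 ^ N)) ^ ((n : ℝ) / 2) := by
    intro k
    simp_rw [hnorm]
    rw [integral_const_mul, GaussianFourier.integral_rexp_neg_mul_sq_norm (by positivity)]
    simp
  have hsum : Summable fun k => ∫ ξ, ‖F k ξ‖ := by
    have hg : Summable fun k : ℕ => A * Real.pi ^ ((n : ℝ) / 2) * ((2 : ℝ) ^ (a - n)) ^ k := by
      apply Summable.mul_left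
      apply summable_geometric_of_lt_one (by positivity)
      exact Real.rpow_lt_one_of_one_lt_of_neg (by norm_num) (by linarith)
    refine Summable.of_nonneg_of_le (fun k => by positivity) (fun k => ?_) hg
    rw [hnint]
    have h4 : ((4 : ℝ) ^ k) ^ ((n : ℝ) / 2) = (2 : ℝ) ^ ((n : ℝ) * k) := by
      rw [show (4 : ℝ) = 2 ^ (2 : ℝ) by norm_num, ← Real.rpow_natCast, ← Real.rpow_mul (by norm_num),
        ← Real.rpow_mul (by norm_num)]
      congr 1; ring
    calc (2 : ℝ) ^ (a * k) * A * (Real.pi / (4 ^ k + 4 ^ N)) ^ ((n : ℝ) / 2)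
        ≤ (2 : ℝ) ^ (a * k) * A * (Real.pi / 4 ^ k) ^ ((n : ℝ) / 2) := by
          gcongr
          linarith [show (0 : ℝ) < 4 ^ N by positivity]
      _ = _ := by
          rw [Real.div_rpow (by positivity) (by positivity), h4, ← Real.rpow_natCast,
            ← Real.rpow_mul (by norm_num), sub_mul, Real.rpow_sub (by norm_num)]
          ring
  have hS := hasSum_integral_of_summable_integral_norm hFint hsum
  have hT : (∫ ξ : En n, Complex.exp (Complex.I * ((⟪x, ξ⟫ : ℝ) : ℂ)) * ((mulR n a ξ : ℝ) : ℂ) *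
      ftI n (gaussC n b hb) ξ) = ∫ ξ, ∑' k, F k ξ := by
    congr 1
    ext ξ
    simp only [F]
    rw [tsum_mul_right, tsum_mul_left, mulR, Complex.ofReal_tsum]
  rw [hT]
  simp_rw [hint] at hS
  have hS' := Complex.hasSum_re hS
  simp only [Complex.ofReal_re] at hS'
  refine le_trans ?_ ((le_abs_self _).trans (Complex.abs_re_le_norm _))
  refine le_trans ?_ (le_hasSum hS' N fun k _ => by positivity)
  have h1 : 1 ≤ A * (Real.pi / (4 ^ N + 4 ^ N)) ^ ((n : ℝ) / 2) := by
    rw [hA, ← Real.mul_rpow (by positivity) (by positivity)]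
    apply Real.one_le_rpow _ (by positivity)
    rw [hbdef]
    have hp := Real.pi_gt_three
    have : Real.pi / (4 * (4 : ℝ) ^ N)⁻¹ * (Real.pi / (4 ^ N + 4 ^ N)) = 2 * Real.pi ^ 2 := by
      field_simp; ring
    rw [this]
    nlinarith
  have h2 : Real.exp (-b * ‖x‖ ^ 2) ≤ Real.exp (-(4 * ((4 : ℝ) ^ N + 4 ^ N))⁻¹ * ‖x‖ ^ 2) := by
    gcongr
    rw [hbdef]
    gcongr
    linarith [show (0 : ℝ) < 4 ^ N by positivity]
  calc (2 : ℝ) ^ (a * N) * Real.exp (-b * ‖x‖ ^ 2)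
      ≤ (2 : ℝ) ^ (a * N) * ((A * (Real.pi / (4 ^ N + 4 ^ N)) ^ ((n : ℝ) / 2)) *
        Real.exp (-(4 * ((4 : ℝ) ^ N + 4 ^ N))⁻¹ * ‖x‖ ^ 2)) := by
        gcongr
        calc _ = 1 * Real.exp (-b * ‖x‖ ^ 2) := (one_mul _).symm
          _ ≤ _ := by gcongr
    _ = _ := by ring

lemma idiff_continuous {V : Type*} [TopologicalSpace V] [Add V] [ContinuousAdd V] (h : V) (r : ℕ)
    (F : V → ℂ) (hF : Continuous F) : Continuous ((idiff h)^[r] F) := by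
  induction r generalizing F with
  | zero => exact hF
  | succ r ih =>
    rw [Function.iterate_succ_apply]
    apply ih
    unfold idiff
    fun_prop

/-- The second function is the derivative of the first in direction `e`. -/
def DirDeriv {n : ℕ} (e : En n) (F F' : En n → ℂ) : Prop :=
  ∀ x : En n, ∀ u : ℝ, HasDerivAt (fun u : ℝ => F (x + u • e)) (F' (x + u • e)) u

lemma DirDeriv.idiff {n : ℕ} {e : En n} {F F' : En n → ℂ} (h : DirDeriv e F F') (v : En n) (r : ℕ) :
    DirDeriv e ((idiff v)^[r] F) ((idiff v)^[r] F') := by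
  induction r generalizing F F' with
  | zero => exact h
  | succ r ih =>
    rw [Function.iterate_succ_apply, Function.iterate_succ_apply]
    apply ih
    intro x u
    have h1 := h (x + v) u
    have h2 := h x u
    simp only [add_right_comm x v] at h1
    exact h1.sub h2

lemma l1_diff_le {n : ℕ} {e : En n} {F F' : En n → ℂ} (h : DirDeriv e F F') (hF' : Continuous F')
    {t : ℝ} (ht : 0 ≤ t) :
    ∫⁻ x, ‖idiff (t • e) F x‖ₑ ≤ ENNReal.ofReal t * ∫⁻ x, ‖F' x‖ₑ := by
  have hpt : ∀ x, ‖idiff (t • e) F x‖ₑ ≤ ∫⁻ u in Set.Ioc 0 t, ‖F' (x + u • e)‖ₑ := by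
    intro x
    have hc : Continuous fun u : ℝ => F' (x + u • e) := by fun_prop
    have := intervalIntegral.integral_eq_sub_of_hasDerivAt (a := 0) (b := t)
      (fun u _ => h x u) (hc.intervalIntegrable _ _)
    unfold idiff
    rw [zero_smul, add_zero] at this
    rw [← this, intervalIntegral.integral_of_le ht]
    exact enorm_integral_le_lintegral_enorm _
  calc _ ≤ ∫⁻ x, ∫⁻ u in Set.Ioc 0 t, ‖F' (x + u • e)‖ₑ := lintegral_mono hpt
    _ = ∫⁻ u in Set.Ioc 0 t, ∫⁻ x, ‖F' (x + u • e)‖ₑ := by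
      rw [lintegral_lintegral_swap]
      apply Measurable.aemeasurable
      apply Continuous.measurable
      fun_prop
    _ = ∫⁻ u in Set.Ioc 0 t, ∫⁻ x, ‖F' x‖ₑ := by
      congr 1
      ext u
      exact lintegral_add_right_eq_self (fun x => ‖F' x‖ₑ) (u • e)
    _ = _ := by
      rw [setLIntegral_const, Real.volume_Ioc, sub_zero, mul_comm]

lemma l1_diff_iter_le {n : ℕ} {e : En n} (F : ℕ → En n → ℂ) (h : ∀ k, DirDeriv e (F k) (F (k + 1)))
    (hF : ∀ k, Continuous (F k)) {t : ℝ} (ht : 0 ≤ t) (r k : ℕ) :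
    ∫⁻ x, ‖(idiff (t • e))^[r] (F k) x‖ₑ ≤ ENNReal.ofReal t ^ r * ∫⁻ x, ‖F (k + r) x‖ₑ := by
  induction r generalizing k with
  | zero => simp
  | succ r ih =>
    rw [Function.iterate_succ_apply']
    refine (l1_diff_le ((h k).idiff _ r) (idiff_continuous _ _ _ (hF _)) ht).trans ?_
    calc _ ≤ ENNReal.ofReal t * (ENNReal.ofReal t ^ r * ∫⁻ x, ‖F (k + 1 + r) x‖ₑ) := by
          gcongr; exact ih (k + 1)
      _ = _ := by rw [pow_succ', mul_assoc, add_right_comm, add_assoc k r 1]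

lemma l1_diff_iter_le_two {n : ℕ} (v : En n) (F : En n → ℂ) (hF : Continuous F) (r : ℕ) :
    ∫⁻ x, ‖(idiff v)^[r] F x‖ₑ ≤ 2 ^ r * ∫⁻ x, ‖F x‖ₑ := by
  induction r with
  | zero => simp
  | succ r ih =>
    rw [Function.iterate_succ_apply']
    set G := (idiff v)^[r] F
    have hG : Continuous G := idiff_continuous _ _ _ hF
    calc ∫⁻ x, ‖idiff v G x‖ₑ ≤ ∫⁻ x, (‖G (x + v)‖ₑ + ‖G x‖ₑ) :=
          lintegral_mono fun x => enorm_sub_le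
      _ = 2 * ∫⁻ x, ‖G x‖ₑ := by
          rw [lintegral_add_right _ hG.measurable.enorm,
            lintegral_add_right_eq_self (fun x => ‖G x‖ₑ) v, two_mul]
      _ ≤ 2 * (2 ^ r * ∫⁻ x, ‖F x‖ₑ) := by gcongr
      _ = _ := by rw [pow_succ', mul_assoc]

lemma schwartz_l1 {n : ℕ} (f : SchwartzMap (En n) ℂ) : ∫⁻ x, ‖f x‖ₑ ≠ ⊤ :=
  (f.integrable (μ := volume)).2.ne

open LineDeriv in
lemma schwartz_dirDeriv {n : ℕ} (e : En n) (f : SchwartzMap (En n) ℂ) :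
    DirDeriv e f (∂_{e} f : SchwartzMap (En n) ℂ) := by
  intro x u
  rw [SchwartzMap.lineDerivOp_apply_eq_fderiv]
  have h1 : HasDerivAt (fun u : ℝ => x + u • e) e u := by
    simpa using ((hasDerivAt_id u).smul_const e).const_add x
  exact (f.hasFDerivAt (x + u • e)).comp_hasDerivAt u h1

open LineDeriv in
lemma schwartz_diff_bound {n : ℕ} (e : En n) (f : SchwartzMap (En n) ℂ) (r : ℕ) (β : ℝ) (hβ0 : 0 ≤ β)
    (hβ : β ≤ r) : ∃ K : ℝ≥0∞, K ≠ ⊤ ∧ ∀ t : ℝ, 0 < t →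
      ∫⁻ x, ‖(idiff (t • e))^[r] f x‖ₑ ≤ K * ENNReal.ofReal (t ^ β) := by
  let S : ℕ → SchwartzMap (En n) ℂ := fun k => (fun g : SchwartzMap (En n) ℂ => ∂_{e} g)^[k] f
  have hS : ∀ k, DirDeriv e (S k) (S (k + 1)) := by
    intro k
    simp only [S]
    rw [Function.iterate_succ_apply']
    exact schwartz_dirDeriv e _
  refine ⟨(∫⁻ x, ‖S r x‖ₑ) + 2 ^ r * ∫⁻ x, ‖f x‖ₑ, ?_, ?_⟩
  · exact ENNReal.add_ne_top.2 ⟨schwartz_l1 _, ENNReal.mul_ne_top (by simp) (schwartz_l1 _)⟩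
  intro t ht
  rw [add_mul]
  rcases le_total t 1 with h1 | h1
  · refine le_trans ?_ le_self_add
    have := l1_diff_iter_le (fun k => S k) hS (fun k => (S k).continuous) ht.le r 0
    simp only [zero_add] at this
    refine this.trans ?_
    rw [mul_comm, ← ENNReal.ofReal_pow ht.le]
    gcongr
    rw [← Real.rpow_natCast]
    exact Real.rpow_le_rpow_of_exponent_ge ht h1 hβ
  · refine le_trans ?_ le_add_self
    refine (l1_diff_iter_le_two (t • e) f f.continuous r).trans ?_
    have : 1 ≤ ENNReal.ofReal (t ^ β) := by
      rw [ENNReal.one_le_ofReal]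
      exact Real.one_le_rpow h1 hβ0
    exact le_mul_of_one_le_right' this

lemma idiff_iter_scale {n : ℕ} (c : ℝ) (C : ℂ) (v : En n) (F : En n → ℂ) (r : ℕ) (x : En n) :
    (idiff v)^[r] (fun y => C * F (c • y)) x = C * (idiff (c • v))^[r] F (c • x) := by
  induction r generalizing x with
  | zero => rfl
  | succ r ih =>
    rw [Function.iterate_succ_apply', Function.iterate_succ_apply']
    unfold idiff at ih ⊢
    rw [ih, ih, smul_add]
    ring

lemma lintegral_scale {n : ℕ} {c : ℝ} (hc : 0 < c) (f : En n → ℝ≥0∞) (hf : Measurable f) :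
    ∫⁻ x, f (c • x) = ENNReal.ofReal ((c ^ n)⁻¹) * ∫⁻ x, f x := by
  have h := Measure.map_addHaar_smul (volume : Measure (En n)) hc.ne'
  rw [← lintegral_map hf (measurable_const_smul c), h, lintegral_smul_measure]
  simp [abs_of_pos hc]

lemma idiff_hasSum_s9 {V : Type*} [AddMonoid V] (v : V) (F : ℕ → V → ℂ) (G : V → ℂ) (r : ℕ) (x : V)
    (h : ∀ i : ℕ, HasSum (fun k => F k (x + i • v)) (G (x + i • v))) :
    HasSum (fun k => (idiff v)^[r] (F k) x) ((idiff v)^[r] G x) := by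
  induction r generalizing x with
  | zero => simpa using h 0
  | succ r ih =>
    simp only [Function.iterate_succ_apply']
    have h1 := ih x h
    have h2 := ih (x + v) (fun i => by
      have := h (i + 1)
      simpa only [add_comm i 1, add_nsmul, one_nsmul, ← add_assoc] using this)
    exact h2.sub h1

/-- One term of the multiplier. -/
def mterm (n : ℕ) (a : ℝ) (k : ℕ) : En n → ℂ :=
  fun ξ => (((2 : ℝ) ^ (a * k) : ℝ) : ℂ) * gaussC n 1 one_pos ((2 : ℝ) ^ k • ξ)

lemma mterm_apply (n : ℕ) (a : ℝ) (k : ℕ) (ξ : En n) :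
    mterm n a k ξ = (((2 : ℝ) ^ (a * k) * Real.exp (-(4 : ℝ) ^ k * ‖ξ‖ ^ 2) : ℝ) : ℂ) := by
  unfold mterm
  rw [gaussC_apply, norm_smul, mul_pow, Real.norm_of_nonneg (by positivity), ← pow_mul, mul_comm k 2,
    pow_mul]
  push_cast
  norm_num

lemma mterm_hasSum (n : ℕ) (hn : 1 ≤ n) (a : ℝ) (han : a < n) (ξ : En n) (hξ : ξ ≠ 0) :
    HasSum (fun k => mterm n a k ξ) ((mulR n a ξ : ℝ) : ℂ) := by
  simp_rw [mterm_apply]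
  rw [Complex.hasSum_ofReal]
  apply Summable.hasSum
  set c := ‖ξ‖ ^ 2
  have hc : 0 < c := by have := norm_pos_iff.2 hξ; positivity
  have hn' : (1 : ℝ) ≤ n := by exact_mod_cast hn
  have hg : Summable fun k : ℕ => (n ! * (c ^ n)⁻¹) * ((2 : ℝ) ^ (a - 2 * n)) ^ k := by
    apply Summable.mul_left
    apply summable_geometric_of_lt_one (by positivity)
    exact Real.rpow_lt_one_of_one_lt_of_neg (by norm_num) (by linarith)
  refine Summable.of_nonneg_of_le (fun k => by positivity) (fun k => ?_) hg
  have h1 := Real.pow_div_factorial_le_exp ((4 : ℝ) ^ k * c) (by positivity) n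
  have h2 : Real.exp (-(4 : ℝ) ^ k * c) ≤ n ! / ((4 : ℝ) ^ k * c) ^ n := by
    rw [neg_mul, Real.exp_neg, inv_le_comm₀ (Real.exp_pos _) (by positivity), inv_div]
    exact h1
  have h4 : ((4 : ℝ) ^ k) ^ n = (2 : ℝ) ^ (2 * (n : ℝ) * k) := by
    rw [show (4 : ℝ) = 2 ^ (2 : ℝ) by norm_num, ← Real.rpow_natCast, ← Real.rpow_natCast,
      ← Real.rpow_mul (by norm_num), ← Real.rpow_mul (by norm_num)]
    congr 1; ring
  calc (2 : ℝ) ^ (a * k) * Real.exp (-(4 : ℝ) ^ k * c)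
      ≤ (2 : ℝ) ^ (a * k) * (n ! / ((4 : ℝ) ^ k * c) ^ n) := by gcongr
    _ = _ := by
      rw [mul_pow, h4, ← Real.rpow_natCast _ k, ← Real.rpow_mul (by norm_num), sub_mul,
        Real.rpow_sub (by norm_num)]
      field_simp

lemma mul_diff_bound (n : ℕ) (hn : 1 ≤ n) (a : ℝ) (e : En n) (r : ℕ) (β : ℝ) (hβ0 : 0 ≤ β)
    (hβ : β ≤ r) (ha : a + β < n) : ∃ K : ℝ≥0∞, K ≠ ⊤ ∧ ∀ t : ℝ, 0 < t →
      ∫⁻ x, ‖(idiff (t • e))^[r] (fun ξ => ((mulR n a ξ : ℝ) : ℂ)) x‖ₑ ≤ K * ENNReal.ofReal (t ^ β) := by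
  obtain ⟨K, hK, hKt⟩ := schwartz_diff_bound e (gaussC n 1 one_pos) r β hβ0 hβ
  have : Nonempty (Fin n) := ⟨⟨0, hn⟩⟩
  have hq : (2 : ℝ) ^ (a + β - n) < 1 :=
    Real.rpow_lt_one_of_one_lt_of_neg (by norm_num) (by linarith)
  refine ⟨K * ∑' k : ℕ, ENNReal.ofReal (((2 : ℝ) ^ (a + β - n)) ^ k), ?_, ?_⟩
  · apply ENNReal.mul_ne_top hK
    exact (summable_geometric_of_lt_one (by positivity) hq).tsum_ofReal_ne_top
  intro t ht
  have hae : ∀ᵐ x : En n, ‖(idiff (t • e))^[r] (fun ξ => ((mulR n a ξ : ℝ) : ℂ)) x‖ₑ ≤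
      ∑' k, ‖(idiff (t • e))^[r] (mterm n a k) x‖ₑ := by
    have hcount : (Set.range fun i : ℕ => -(i • (t • e))).Countable := Set.countable_range _
    filter_upwards [hcount.ae_notMem volume] with x hx
    have hs := idiff_hasSum_s9 (t • e) (mterm n a) (fun ξ => ((mulR n a ξ : ℝ) : ℂ)) r x (fun i => by
      apply mterm_hasSum n hn a (by linarith)
      intro h0
      exact hx ⟨i, (eq_neg_of_add_eq_zero_left h0).symm⟩)
    rw [← hs.tsum_eq]
    exact enorm_tsum_le_tsum_enorm
  have hmc : ∀ k, Continuous (mterm n a k) := by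
    intro k
    unfold mterm
    have := (gaussC n 1 one_pos).continuous
    fun_prop
  refine (lintegral_mono_ae hae).trans ?_
  rw [lintegral_tsum fun k => (idiff_continuous _ _ _ (hmc k)).measurable.enorm.aemeasurable]
  rw [mul_right_comm, ← ENNReal.tsum_mul_left]
  refine ENNReal.tsum_le_tsum fun k => ?_
  have h2k : (0 : ℝ) < 2 ^ k := by positivity
  have hcont : Continuous ((idiff (((2 : ℝ) ^ k * t) • e))^[r] (gaussC n 1 one_pos)) :=
    idiff_continuous _ _ _ (gaussC n 1 one_pos).continuous
  calc ∫⁻ x, ‖(idiff (t • e))^[r] (mterm n a k) x‖ₑ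
      = ∫⁻ x, ENNReal.ofReal ((2 : ℝ) ^ (a * k)) *
        ‖(idiff (((2 : ℝ) ^ k * t) • e))^[r] (gaussC n 1 one_pos) ((2 : ℝ) ^ k • x)‖ₑ := by
        congr 1
        ext x
        unfold mterm
        rw [idiff_iter_scale, enorm_mul, smul_smul]
        congr 1
        rw [← ofReal_norm, Complex.norm_real, Real.norm_of_nonneg (by positivity)]
    _ = ENNReal.ofReal ((2 : ℝ) ^ (a * k)) * (ENNReal.ofReal ((((2 : ℝ) ^ k) ^ n)⁻¹) *
        ∫⁻ x, ‖(idiff (((2 : ℝ) ^ k * t) • e))^[r] (gaussC n 1 one_pos) x‖ₑ) := by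
        rw [lintegral_const_mul _ (by
          exact (hcont.comp (continuous_const_smul _)).measurable.enorm)]
        rw [lintegral_scale h2k (fun x => ‖(idiff (((2 : ℝ) ^ k * t) • e))^[r] (gaussC n 1 one_pos) x‖ₑ)
          hcont.measurable.enorm]
    _ ≤ ENNReal.ofReal ((2 : ℝ) ^ (a * k)) * (ENNReal.ofReal ((((2 : ℝ) ^ k) ^ n)⁻¹) *
        (K * ENNReal.ofReal (((2 : ℝ) ^ k * t) ^ β))) := by
        gcongr
        exact hKt _ (by positivity)
    _ = K * (ENNReal.ofReal ((2 : ℝ) ^ (a * k)) * ENNReal.ofReal ((((2 : ℝ) ^ k) ^ n)⁻¹) *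
        ENNReal.ofReal (((2 : ℝ) ^ k * t) ^ β)) := by ring
    _ = K * (ENNReal.ofReal (t ^ β) * ENNReal.ofReal (((2 : ℝ) ^ (a + β - n)) ^ k)) := by
        congr 1
        rw [← ENNReal.ofReal_mul (by positivity), ← ENNReal.ofReal_mul (by positivity),
          ← ENNReal.ofReal_mul (by positivity)]
        congr 1
        rw [Real.mul_rpow (by positivity) ht.le, ← Real.rpow_natCast _ n, ← Real.rpow_natCast 2 k,
          ← Real.rpow_natCast _ k, ← Real.rpow_mul (by norm_num), ← Real.rpow_mul (by norm_num),
          ← Real.rpow_mul (by norm_num), ← Real.rpow_neg (by norm_num)]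
        rw [show (a + β - n) * (k : ℝ) = a * k + -(k * n) + k * β by ring,
          Real.rpow_add (by norm_num), Real.rpow_add (by norm_num)]
        ring
    _ = _ := by ring

lemma volume_dyadicCube (n j : ℕ) (k : Fin n → ℤ) :
    volume (dyadicCube n j k) ≤ ENNReal.ofReal ((2 : ℝ) ^ (-((n : ℝ) * j))) := by
  have h : dyadicCube n j k = (WithLp.ofLp) ⁻¹' (Set.univ.pi fun i =>
      Set.Icc ((2 : ℝ) ^ (-(j : ℝ)) * k i) ((2 : ℝ) ^ (-(j : ℝ)) * (k i + 1))) := by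
    ext x
    simp only [dyadicCube, Set.mem_ofPred_eq, Set.mem_preimage, Set.mem_univ_pi]
  have hm : MeasurableSet (Set.univ.pi fun i =>
      Set.Icc ((2 : ℝ) ^ (-(j : ℝ)) * k i) ((2 : ℝ) ^ (-(j : ℝ)) * (k i + 1))) :=
    MeasurableSet.univ_pi fun i => measurableSet_Icc
  rw [h, (PiLp.volume_preserving_ofLp (Fin n)).measure_preimage hm.nullMeasurableSet, volume_pi_pi]
  simp_rw [Real.volume_Icc]
  rw [← ENNReal.ofReal_prod_of_nonneg]
  · apply le_of_eq
    congr 1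
    simp_rw [← mul_sub, add_sub_cancel_left, mul_one]
    rw [Finset.prod_const, Finset.card_univ, Fintype.card_fin, ← Real.rpow_natCast,
      ← Real.rpow_mul (by norm_num)]
    congr 1; ring
  · intro i _
    rw [← mul_sub, add_sub_cancel_left]
    positivity

lemma idiff_snd {n : ℕ} (v : En n) (m : En n → ℂ) (r : ℕ) (x ξ : En n) :
    (idiff ((0 : En n), v))^[r] (fun X : En n × En n => m X.2) (x, ξ) = (idiff v)^[r] m ξ := by
  induction r generalizing ξ with
  | zero => rfl
  | succ r ih =>
    rw [Function.iterate_succ_apply', Function.iterate_succ_apply']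
    unfold idiff at ih ⊢
    rw [ih, Prod.mk_add_mk, add_zero, ih]

lemma idiff_fst {n : ℕ} (v : En n) (m : En n → ℂ) (r : ℕ) (X : En n × En n) :
    (idiff (v, (0 : En n)))^[r + 1] (fun X : En n × En n => m X.2) X = 0 := by
  induction r generalizing X with
  | zero => simp [idiff]
  | succ r ih =>
    rw [Function.iterate_succ_apply']
    unfold idiff at ih ⊢
    rw [ih, ih, sub_zero]

lemma omega_bound (n : ℕ) (hn : 1 ≤ n) (a β : ℝ) (hβ0 : 0 ≤ β) (hβ : β ≤ n) (ha : a + β < n) :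
    ∃ K : ℝ≥0∞, K ≠ ⊤ ∧ ∀ j : ℕ,
      omegaSymb n (fun X : En n × En n => ((mulR n a X.2 : ℝ) : ℂ)) j ≤
        K * ENNReal.ofReal ((2 : ℝ) ^ (-((n + β) * j))) := by
  obtain ⟨K0, hK0, h0⟩ := mul_diff_bound n hn a 0 0 0 le_rfl (by simp) (by linarith)
  choose K hK h using fun i : Fin n => mul_diff_bound n hn a (unitE n i) n β hβ0 hβ ha
  refine ⟨K0 + ∑ i, K i, ?_, ?_⟩
  · exact ENNReal.add_ne_top.2 ⟨hK0, ENNReal.sum_ne_top.2 fun i _ => hK i⟩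
  intro j
  cases j with
  | zero =>
    simp only [omegaSymb]
    refine iSup_le fun k => ?_
    have h1 := h0 1 one_pos
    simp only [Function.iterate_zero, id_eq, Real.rpow_zero, ENNReal.ofReal_one, mul_one] at h1
    have hv := volume_dyadicCube n 0 k
    simp only [Nat.cast_zero, mul_zero, neg_zero, Real.rpow_zero, ENNReal.ofReal_one, mul_one] at hv ⊢
    rw [setLIntegral_const]
    refine (mul_le_mul' h1 hv).trans ?_
    rw [mul_one]
    exact le_self_add
  | succ j =>
    simp only [omegaSymb]
    refine iSup_le fun k => iSup_le fun e => iSup_le fun he => ?_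
    rcases he with ⟨i, rfl⟩ | ⟨i, rfl⟩
    · obtain ⟨r, rfl⟩ : ∃ r, n = r + 1 := ⟨n - 1, by omega⟩
      simp only [Prod.smul_mk, smul_zero]
      simp only [idiff_fst _ (fun ξ => ((mulR (r + 1) a ξ : ℝ) : ℂ))]
      simp
    · simp only [Prod.smul_mk, smul_zero]
      simp_rw [idiff_snd _ (fun ξ => ((mulR n a ξ : ℝ) : ℂ))]
      rw [setLIntegral_const]
      refine (mul_le_mul' (h i _ (by positivity)) (volume_dyadicCube n (j + 1) k)).trans ?_
      rw [mul_assoc, ← ENNReal.ofReal_mul (by positivity), ← Real.rpow_mul (by norm_num),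
        ← Real.rpow_add (by norm_num)]
      gcongr ?_ * ENNReal.ofReal ?_
      · exact (Finset.single_le_sum (f := K) (fun _ _ => zero_le) (Finset.mem_univ i)).trans le_add_self
      · apply le_of_eq
        congr 1
        push_cast
        ring

/-- For every `0 < s < n` there is a measurable symbol `σ` on `ℝⁿ × ℝⁿ` belonging to `B^s`,
i.e. with `∑_{j≥0} 2^{(n+s)j} ω(j) < ∞`, such that for every `1 ≤ p ≤ ∞` the symbol operator
`σ(x,D) f(x) = ∫ e^{i x·ξ} σ(x,ξ) f̂(ξ) dξ` is not bounded from `L^p(ℝⁿ)` to `L^p(ℝⁿ)`. -/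
theorem stmt_9 (n : ℕ) (hn : 1 ≤ n) (s : ℝ) (hs0 : 0 < s) (hsn : s < n) :
    ∃ σ : En n × En n → ℂ, Measurable σ ∧
      (∑' j : ℕ, ENNReal.ofReal ((2 : ℝ) ^ (((n : ℝ) + s) * j)) * omegaSymb n σ j) ≠ ⊤ ∧
      ∀ p : ℝ≥0∞, 1 ≤ p → ¬∃ C : ℝ, ∀ f : SchwartzMap (En n) ℂ,
        eLpNorm (fun x : En n => ∫ ξ : En n,
            Complex.exp (Complex.I * ((⟪x, ξ⟫ : ℝ) : ℂ)) * σ (x, ξ) * ftI n (⇑f) ξ) p volume ≤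
          ENNReal.ofReal C * eLpNorm (⇑f) p volume := by
  have hnr : (1 : ℝ) ≤ n := by exact_mod_cast hn
  set a : ℝ := (n - s) / 4 with ha
  have ha0 : 0 < a := by rw [ha]; linarith
  refine ⟨fun X => ((mulR n a X.2 : ℝ) : ℂ), ?_, ?_, ?_⟩
  · exact Complex.measurable_ofReal.comp ((mulR_measurable n a).comp measurable_snd)
  · obtain ⟨K, hK, h⟩ := omega_bound n hn a ((n + s) / 2) (by linarith) (by linarith)
      (by rw [ha]; linarith)
    have hq : (2 : ℝ) ^ ((s - n) / 2) < 1 :=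
      Real.rpow_lt_one_of_one_lt_of_neg (by norm_num) (by linarith)
    refine ne_top_of_le_ne_top (b := K * ∑' j : ℕ, ENNReal.ofReal (((2 : ℝ) ^ ((s - n) / 2)) ^ j)) ?_ ?_
    · apply ENNReal.mul_ne_top hK
      exact (summable_geometric_of_lt_one (by positivity) hq).tsum_ofReal_ne_top
    · rw [← ENNReal.tsum_mul_left]
      refine ENNReal.tsum_le_tsum fun j => ?_
      refine (mul_le_mul' le_rfl (h j)).trans ?_
      rw [mul_left_comm, ← ENNReal.ofReal_mul (by positivity), ← Real.rpow_add (by norm_num),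
        ← Real.rpow_natCast _ j, ← Real.rpow_mul (by norm_num)]
      apply le_of_eq
      congr 3
      ring
  · rintro p hp ⟨C, hC⟩
    have hall : ∀ N : ℕ, ((2 : ℝ) ^ a) ^ N ≤ C := by
      intro N
      have hb : 0 < (4 * (4 : ℝ) ^ N)⁻¹ := by positivity
      set g := gaussC n (4 * (4 : ℝ) ^ N)⁻¹ hb with hg
      have h1 := hC g
      have hfin : eLpNorm (⇑g) p volume ≠ ⊤ := (g.memLp p volume).2.ne
      have hne : eLpNorm (⇑g) p volume ≠ 0 := by
        rw [Ne, eLpNorm_eq_zero_iff g.continuous.aestronglyMeasurable (by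
          intro h; rw [h] at hp; simp at hp)]
        intro h0
        obtain ⟨x, hx⟩ := h0.exists
        rw [hg, gaussC_apply] at hx
        simp [Complex.exp_ne_zero] at hx
      have h2 : ENNReal.ofReal (((2 : ℝ) ^ a) ^ N) * eLpNorm (⇑g) p volume ≤
          ENNReal.ofReal C * eLpNorm (⇑g) p volume := by
        refine le_trans ?_ h1
        have h3 : eLpNorm ((((2 : ℝ) ^ a) ^ N) • (⇑g)) p volume =
            ENNReal.ofReal (((2 : ℝ) ^ a) ^ N) * eLpNorm (⇑g) p volume := by
          rw [eLpNorm_const_smul, ← ofReal_norm, Real.norm_of_nonneg (by positivity)]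
        rw [← h3]
        refine eLpNorm_mono fun x => ?_
        refine le_trans (le_of_eq ?_) (op_gauss_lower n hn a (by rw [ha]; linarith) N x hb)
        rw [Pi.smul_apply, norm_smul, hg, gaussC_apply, Complex.norm_real,
          Real.norm_of_nonneg (by positivity), Real.norm_of_nonneg (by positivity),
          ← Real.rpow_natCast _ N, ← Real.rpow_mul (by norm_num)]
      rw [ENNReal.mul_le_mul_iff_left hne hfin] at h2
      exact (ENNReal.ofReal_le_ofReal_iff'.1 h2).resolve_right (by
        have : 0 < ((2 : ℝ) ^ a) ^ N := by positivity
        linarith)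
    obtain ⟨N, hN⟩ := pow_unbounded_of_one_lt C (Real.one_lt_rpow (by norm_num : (1 : ℝ) < 2) ha0)
    exact absurd (hall N) (not_le.2 hN)
end
end
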